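/- For every permutation σ of [n+1] there exists exactly one triangulation T of P such that σ(s_δ) < σ(t_δ) for every δ ∈ T (i.e., σ is a linear extension of the spine of T); moreover, for this triangulation T, every u ∈ ℝ^{n+1} with u_{σ⁻¹(1)} ≤ u_{σ⁻¹(2)} ≤ … ≤ u_{σ⁻¹(n+1)} satisfies ⟨u, x(T)⟩ ≥ ⟨u, x(T')⟩ for all triangulations T' of P. -/

import Mathlib

attribute [local instance] Classical.propDecidable

noncomputable section

namespace Spines

/-- Position of vertex `v ∈ {0,…,n+2}` in the counterclockwise boundary cyclic order:
`0`, then the elements of `D` in increasing order, then `n+2`, then the elements of `U`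
in decreasing order. -/
def pos (n : ℕ) (D U : Finset ℕ) (v : ℕ) : ℕ :=
  if v = 0 then 0
  else if v = n + 2 then D.card + 1
  else if v ∈ D then 1 + (D.filter (fun d => d < v)).card
  else D.card + 2 + (U.filter (fun u => v < u)).card

/-- Cyclic distance from `a` to `v` in counterclockwise direction. -/
def relpos (n : ℕ) (D U : Finset ℕ) (a v : ℕ) : ℕ :=
  (pos n D U v + (n + 3) - pos n D U a) % (n + 3)

/-- `v` lies strictly inside the counterclockwise boundary arc from `a` to `b`. -/
def StrictBetween (n : ℕ) (D U : Finset ℕ) (a b v : ℕ) : Prop :=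
  v ≤ n + 2 ∧ 0 < relpos n D U a v ∧ relpos n D U a v < relpos n D U a b

/-- A diagonal, encoded as an ordered pair `(a,b)` with `a < b ≤ n+2`. -/
def IsDiag (n : ℕ) (δ : ℕ × ℕ) : Prop := δ.1 < δ.2 ∧ δ.2 ≤ n + 2

/-- A boundary edge: the endpoints are adjacent in the cyclic order. -/
def IsBoundaryEdge (n : ℕ) (D U : Finset ℕ) (δ : ℕ × ℕ) : Prop :=
  IsDiag n δ ∧ (relpos n D U δ.1 δ.2 = 1 ∨ relpos n D U δ.2 δ.1 = 1)

/-- An internal diagonal. -/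
def IsInternalDiag (n : ℕ) (D U : Finset ℕ) (δ : ℕ × ℕ) : Prop :=
  IsDiag n δ ∧ ¬ IsBoundaryEdge n D U δ

/-- Two diagonals cross: the four endpoints are pairwise distinct and exactly one
endpoint of the second lies strictly inside each of the two arcs determined by the first. -/
def Cross (n : ℕ) (D U : Finset ℕ) (δ δ' : ℕ × ℕ) : Prop :=
  δ.1 ≠ δ.2 ∧ δ'.1 ≠ δ'.2 ∧ δ.1 ≠ δ'.1 ∧ δ.1 ≠ δ'.2 ∧ δ.2 ≠ δ'.1 ∧ δ.2 ≠ δ'.2 ∧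
  ((StrictBetween n D U δ.1 δ.2 δ'.1 ∧ StrictBetween n D U δ.2 δ.1 δ'.2) ∨
   (StrictBetween n D U δ.1 δ.2 δ'.2 ∧ StrictBetween n D U δ.2 δ.1 δ'.1))

/-- A triangulation: a maximal set of pairwise non-crossing internal diagonals. -/
def IsTriangulation (n : ℕ) (D U : Finset ℕ) (T : Finset (ℕ × ℕ)) : Prop :=
  (∀ δ ∈ T, IsInternalDiag n D U δ) ∧
  (∀ δ ∈ T, ∀ δ' ∈ T, ¬ Cross n D U δ δ') ∧
  (∀ δ, IsInternalDiag n D U δ → δ ∉ T → ∃ δ' ∈ T, Cross n D U δ δ')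

/-- `a` and `b` (with `a < b`) are joined by a diagonal of `T` or a boundary edge. -/
def EdgeOf (n : ℕ) (D U : Finset ℕ) (T : Finset (ℕ × ℕ)) (a b : ℕ) : Prop :=
  (a, b) ∈ T ∨ IsBoundaryEdge n D U (a, b)

/-- `{i,j,k}` with `i<j<k` is a triangle of the triangulation `T`. -/
def IsTriangleOf (n : ℕ) (D U : Finset ℕ) (T : Finset (ℕ × ℕ)) (i j k : ℕ) : Prop :=
  i < j ∧ j < k ∧ k ≤ n + 2 ∧
    EdgeOf n D U T i j ∧ EdgeOf n D U T j k ∧ EdgeOf n D U T i k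

/-- `Bel δ`: labels in `[n+1]` strictly inside the ccw arc from `δ.1` to `δ.2`,
together with the endpoints of `δ` lying in `U`. -/
def Bel (n : ℕ) (D U : Finset ℕ) (δ : ℕ × ℕ) : Finset ℕ :=
  (Finset.Icc 1 (n + 1)).filter
    (fun j => StrictBetween n D U δ.1 δ.2 j ∨ (j ∈ U ∧ (j = δ.1 ∨ j = δ.2)))

def bel (n : ℕ) (D U : Finset ℕ) (δ : ℕ × ℕ) : ℕ := (Bel n D U δ).card

def Abo (n : ℕ) (D U : Finset ℕ) (δ : ℕ × ℕ) : Finset ℕ :=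
  Finset.Icc 1 (n + 1) \ Bel n D U δ

/-- The coordinates of the point `x(T)` associated to a triangulation `T`. -/
def xcoord (n : ℕ) (D U : Finset ℕ) (T : Finset (ℕ × ℕ)) (j : ℕ) : ℝ :=
  if h : ∃ p : ℕ × ℕ, IsTriangleOf n D U T p.1 j p.2 then
    if j ∈ D then
      ((bel n D U (h.choose.1, j) : ℝ) + 1) * ((bel n D U (j, h.choose.2) : ℝ) + 1)
    else
      ((n : ℝ) + 2) -
        (((n : ℝ) + 2) - (bel n D U (h.choose.1, j) : ℝ)) *
          (((n : ℝ) + 2) - (bel n D U (j, h.choose.2) : ℝ))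
  else 0

/-- Middle vertex of the triple `{a,b,c}` with `a < b` and `c ∉ {a,b}`. -/
def midOf (a b c : ℕ) : ℕ := if c < a then a else if c < b then c else b

/-- `c` is the third vertex of a triangle of `T` containing the diagonal `δ`. -/
def TriWith (n : ℕ) (D U : Finset ℕ) (T : Finset (ℕ × ℕ)) (δ : ℕ × ℕ) (c : ℕ) : Prop :=
  if c < δ.1 then IsTriangleOf n D U T c δ.1 δ.2
  else if c < δ.2 then IsTriangleOf n D U T δ.1 c δ.2
  else IsTriangleOf n D U T δ.1 δ.2 c

/-- `s_δ`: middle vertex of the triangle of `T` below `δ` (third vertex strictly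
inside the ccw arc from `δ.1` to `δ.2`). -/
def spineSrc (n : ℕ) (D U : Finset ℕ) (T : Finset (ℕ × ℕ)) (δ : ℕ × ℕ) : ℕ :=
  if h : ∃ c, StrictBetween n D U δ.1 δ.2 c ∧ TriWith n D U T δ c then
    midOf δ.1 δ.2 h.choose
  else 0

/-- `t_δ`: middle vertex of the triangle of `T` above `δ` (third vertex strictly
inside the ccw arc from `δ.2` to `δ.1`). -/
def spineTgt (n : ℕ) (D U : Finset ℕ) (T : Finset (ℕ × ℕ)) (δ : ℕ × ℕ) : ℕ :=
  if h : ∃ c, StrictBetween n D U δ.2 δ.1 c ∧ TriWith n D U T δ c then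
    midOf δ.1 δ.2 h.choose
  else 0

/-- `(p,q)` is an arc of the spine of `T`. -/
def SpineArc (n : ℕ) (D U : Finset ℕ) (T : Finset (ℕ × ℕ)) (p q : ℕ) : Prop :=
  ∃ δ ∈ T, spineSrc n D U T δ = p ∧ spineTgt n D U T δ = q

/-- The finite set of all triangulations of the polygon. -/
def allTri (n : ℕ) (D U : Finset ℕ) : Finset (Finset (ℕ × ℕ)) :=
  ((Finset.range (n + 3) ×ˢ Finset.range (n + 3)).filter
      (fun δ => IsInternalDiag n D U δ)).powerset.filter
    (fun T => IsTriangulation n D U T)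

end Spines

namespace Spines

/-- The down labels `D` and the up labels `U` partition `[n+1]`. -/
structure Split (n : ℕ) (D U : Finset ℕ) : Prop where
  mem_or : ∀ v, (v ∈ D ∨ v ∈ U) ↔ (1 ≤ v ∧ v ≤ n + 1)
  not_both : ∀ v, v ∈ D → v ∉ U

theorem Split.symm {n : ℕ} {D U : Finset ℕ} (h : Split n D U) : Split n U D :=
  ⟨fun v => by rw [or_comm]; exact h.mem_or v, fun v hU hD => h.not_both v hD hU⟩

theorem Split.card_add_card {n : ℕ} {D U : Finset ℕ} (h : Split n D U) :
    D.card + U.card = n + 1 := by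
  have hd : Disjoint D U := Finset.disjoint_left.2 fun v => h.not_both v
  have hu : D ∪ U = Finset.Icc 1 (n + 1) := by
    ext v
    rw [Finset.mem_union, Finset.mem_Icc, h.mem_or]
  rw [← Finset.card_union_of_disjoint hd, hu, Nat.card_Icc]
  omega

theorem pos_zero (n : ℕ) (D U : Finset ℕ) : pos n D U 0 = 0 := by simp [pos]

theorem pos_last (n : ℕ) (D U : Finset ℕ) : pos n D U (n + 2) = D.card + 1 := by simp [pos]

theorem pos_down {n : ℕ} {D U : Finset ℕ} (h : Split n D U) {v : ℕ} (hv : v ∈ D) :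
    pos n D U v = 1 + (D.filter (fun d => d < v)).card := by
  have := (h.mem_or v).1 (Or.inl hv)
  rw [pos, if_neg (by omega), if_neg (by omega), if_pos hv]

theorem pos_up {n : ℕ} {D U : Finset ℕ} (h : Split n D U) {v : ℕ} (hv : v ∈ U) :
    pos n D U v = D.card + 2 + (U.filter (fun u => v < u)).card := by
  have := (h.mem_or v).1 (Or.inr hv)
  rw [pos, if_neg (by omega), if_neg (by omega), if_neg (fun hD => h.not_both v hD hv)]

theorem pos_down_le {n : ℕ} {D U : Finset ℕ} (h : Split n D U) {v : ℕ} (hv : v ∈ D) :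
    1 ≤ pos n D U v ∧ pos n D U v ≤ D.card := by
  rw [pos_down h hv]
  have : (D.filter (fun d => d < v)).card < D.card :=
    Finset.card_lt_card (Finset.filter_ssubset.2 ⟨v, hv, lt_irrefl v⟩)
  omega

theorem pos_up_le {n : ℕ} {D U : Finset ℕ} (h : Split n D U) {v : ℕ} (hv : v ∈ U) :
    D.card + 2 ≤ pos n D U v ∧ pos n D U v ≤ n + 2 := by
  rw [pos_up h hv]
  have : (U.filter (fun u => v < u)).card < U.card :=
    Finset.card_lt_card (Finset.filter_ssubset.2 ⟨v, hv, lt_irrefl v⟩)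
  have := h.card_add_card
  omega

theorem pos_down_lt {n : ℕ} {D U : Finset ℕ} (h : Split n D U) {v w : ℕ} (hv : v ∈ D)
    (hw : w ∈ D) (hvw : v < w) : pos n D U v < pos n D U w := by
  rw [pos_down h hv, pos_down h hw]
  have : (D.filter (fun d => d < v)).card < (D.filter (fun d => d < w)).card := by
    apply Finset.card_lt_card
    refine Finset.ssubset_iff_of_subset ?_ |>.2 ⟨v, by simp [hv, hvw], by simp⟩
    intro x
    simp only [Finset.mem_filter]
    rintro ⟨h1, h2⟩
    exact ⟨h1, h2.trans hvw⟩
  omega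

theorem pos_up_lt {n : ℕ} {D U : Finset ℕ} (h : Split n D U) {v w : ℕ} (hv : v ∈ U)
    (hw : w ∈ U) (hvw : v < w) : pos n D U w < pos n D U v := by
  rw [pos_up h hv, pos_up h hw]
  have : (U.filter (fun u => w < u)).card < (U.filter (fun u => v < u)).card := by
    apply Finset.card_lt_card
    refine Finset.ssubset_iff_of_subset ?_ |>.2 ⟨w, by simp [hw, hvw], by simp⟩
    intro x
    simp only [Finset.mem_filter]
    rintro ⟨h1, h2⟩
    exact ⟨h1, hvw.trans h2⟩
  omega

theorem Split.vertex_cases {n : ℕ} {D U : Finset ℕ} (h : Split n D U) {v : ℕ}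
    (hv : v ≤ n + 2) : v = 0 ∨ v = n + 2 ∨ v ∈ D ∨ v ∈ U := by
  have := h.mem_or v
  by_cases h1 : v = 0
  · exact Or.inl h1
  by_cases h2 : v = n + 2
  · exact Or.inr (Or.inl h2)
  exact Or.inr (Or.inr (this.2 (by omega)))

theorem pos_lt_card {n : ℕ} {D U : Finset ℕ} (h : Split n D U) {v : ℕ} (hv : v ≤ n + 2) :
    pos n D U v < n + 3 := by
  have := h.card_add_card
  rcases h.vertex_cases hv with rfl | rfl | hD | hU
  · rw [pos_zero]; omega
  · rw [pos_last]; omega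
  · have := pos_down_le h hD; omega
  · have := pos_up_le h hU; omega

theorem pos_lt_iff {n : ℕ} {D U : Finset ℕ} (h : Split n D U) {x y : ℕ} (hx : x ≤ n + 2)
    (hy : y ≤ n + 2) : pos n D U x < pos n D U y ↔
      (x = 0 ∧ y ≠ 0) ∨ (x ∈ D ∧ ((y ∈ D ∧ x < y) ∨ y = n + 2 ∨ y ∈ U)) ∨
        (x = n + 2 ∧ y ∈ U) ∨ (x ∈ U ∧ y ∈ U ∧ y < x) := by
  have h0 := pos_zero n D U
  have hl := pos_last n D U
  have hc := h.card_add_card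
  have hd := h.not_both
  have hm := h.mem_or
  rcases h.vertex_cases hx with rfl | rfl | hxD | hxU <;>
  rcases h.vertex_cases hy with rfl | rfl | hyD | hyU
  · grind
  · grind
  · have := pos_down_le h hyD; grind
  · have := pos_up_le h hyU; grind
  · grind
  · grind
  · have := pos_down_le h hyD; grind
  · have := pos_up_le h hyU; grind
  · have := pos_down_le h hxD; grind
  · have := pos_down_le h hxD; grind
  · have h1 := @pos_down_lt _ _ _ h x y hxD hyD
    have h2 := @pos_down_lt _ _ _ h y x hyD hxD
    rcases lt_trichotomy x y with hlt | rfl | hlt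
    · grind
    · grind
    · grind
  · have := pos_down_le h hxD
    have := pos_up_le h hyU
    grind
  · have := pos_up_le h hxU; grind
  · have := pos_up_le h hxU; grind
  · have := pos_down_le h hyD
    have := pos_up_le h hxU
    grind
  · have h1 := @pos_up_lt _ _ _ h x y hxU hyU
    have h2 := @pos_up_lt _ _ _ h y x hyU hxU
    rcases lt_trichotomy x y with hlt | rfl | hlt
    · grind
    · grind
    · grind

theorem pos_inj {n : ℕ} {D U : Finset ℕ} (h : Split n D U) {x y : ℕ} (hx : x ≤ n + 2)
    (hy : y ≤ n + 2) (hxy : pos n D U x = pos n D U y) : x = y := by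
  have h1 := pos_lt_iff h hx hy
  have h2 := pos_lt_iff h hy hx
  have hd := h.not_both
  have hm := h.mem_or
  rw [hxy] at h1 h2
  simp only [lt_irrefl, false_iff] at h1 h2
  rcases h.vertex_cases hx with rfl | rfl | hxD | hxU <;>
  rcases h.vertex_cases hy with rfl | rfl | hyD | hyU <;> grind

theorem exists_pos_eq {n : ℕ} {D U : Finset ℕ} (h : Split n D U) {p : ℕ} (hp : p < n + 3) :
    ∃ v ≤ n + 2, pos n D U v = p := by
  have := Finset.surj_on_of_inj_on_of_card_le (s := Finset.range (n + 3))
    (t := Finset.range (n + 3)) (fun v _ => pos n D U v)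
    (fun v hv => Finset.mem_range.2 (pos_lt_card h (by have := Finset.mem_range.1 hv; omega)))
    (fun x y hx hy hxy => pos_inj h (by have := Finset.mem_range.1 hx; omega)
      (by have := Finset.mem_range.1 hy; omega) hxy) le_rfl p (Finset.mem_range.2 hp)
  obtain ⟨v, hv, hvp⟩ := this
  exact ⟨v, by have := Finset.mem_range.1 hv; omega, hvp.symm⟩

theorem relpos_eq {n : ℕ} {D U : Finset ℕ} (h : Split n D U) {a v : ℕ} (ha : a ≤ n + 2)
    (hv : v ≤ n + 2) : relpos n D U a v =
      if pos n D U a ≤ pos n D U v then pos n D U v - pos n D U a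
      else pos n D U v + (n + 3) - pos n D U a := by
  have h1 := pos_lt_card h ha
  have h2 := pos_lt_card h hv
  rw [relpos]
  split_ifs with hle
  · rw [show pos n D U v + (n + 3) - pos n D U a = pos n D U v - pos n D U a + (n + 3) by omega,
      Nat.add_mod_right, Nat.mod_eq_of_lt (by omega)]
  · rw [Nat.mod_eq_of_lt (by omega)]

theorem strictBetween_iff_pos {n : ℕ} {D U : Finset ℕ} (h : Split n D U) {a b v : ℕ}
    (ha : a ≤ n + 2) (hb : b ≤ n + 2) : StrictBetween n D U a b v ↔ v ≤ n + 2 ∧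
      ((pos n D U a < pos n D U v ∧ pos n D U v < pos n D U b) ∨
       (pos n D U v < pos n D U b ∧ pos n D U b < pos n D U a) ∨
       (pos n D U b < pos n D U a ∧ pos n D U a < pos n D U v)) := by
  rw [StrictBetween]
  refine and_congr_right fun hv => ?_
  have h1 := pos_lt_card h ha
  have h2 := pos_lt_card h hv
  have h3 := pos_lt_card h hb
  rw [relpos_eq h ha hv, relpos_eq h ha hb]
  split_ifs <;> omega

/-- The vertex `v` lies strictly below the diagonal `{a,b}` with `a < b`; exchanging `D` and
`U` expresses that `v` lies strictly above it. -/
def Below (n : ℕ) (D U : Finset ℕ) (a b v : ℕ) : Prop :=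
  v ≤ n + 2 ∧ ((a < v ∧ v < b ∧ v ∈ D) ∨ (v < a ∧ a ∈ U) ∨ (b < v ∧ b ∈ U))

theorem strictBetween_iff_below {n : ℕ} {D U : Finset ℕ} (h : Split n D U) {a b : ℕ}
    (hab : a < b) (hb : b ≤ n + 2) (v : ℕ) :
    StrictBetween n D U a b v ↔ Below n D U a b v := by
  rw [strictBetween_iff_pos h (by omega) hb, Below]
  refine and_congr_right fun hv => ?_
  rw [pos_lt_iff h (by omega) hv, pos_lt_iff h hv hb, pos_lt_iff h hb (by omega)]
  have hd := h.not_both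
  have hm := h.mem_or
  have ha : a ≤ n + 2 := by omega
  rcases h.vertex_cases ha with rfl | rfl | haD | haU <;>
  rcases h.vertex_cases hb with rfl | rfl | hbD | hbU <;>
  rcases h.vertex_cases hv with rfl | rfl | hvD | hvU <;> grind

theorem strictBetween_iff_above {n : ℕ} {D U : Finset ℕ} (h : Split n D U) {a b : ℕ}
    (hab : a < b) (hb : b ≤ n + 2) (v : ℕ) :
    StrictBetween n D U b a v ↔ Below n U D a b v := by
  rw [strictBetween_iff_pos h hb (by omega), Below]
  refine and_congr_right fun hv => ?_
  rw [pos_lt_iff h hb hv, pos_lt_iff h hv (by omega), pos_lt_iff h (by omega) hb]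
  have hd := h.not_both
  have hm := h.mem_or
  have ha : a ≤ n + 2 := by omega
  rcases h.vertex_cases ha with rfl | rfl | haD | haU <;>
  rcases h.vertex_cases hb with rfl | rfl | hbD | hbU <;>
  rcases h.vertex_cases hv with rfl | rfl | hvD | hvU <;> grind

theorem strictBetween_swap {n : ℕ} {D U : Finset ℕ} (h : Split n D U) {a b : ℕ}
    (ha : a ≤ n + 2) (hb : b ≤ n + 2) (hab : a ≠ b) (v : ℕ) :
    StrictBetween n U D a b v ↔ StrictBetween n D U b a v := by
  rcases lt_or_gt_of_ne hab with hlt | hlt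
  · rw [strictBetween_iff_below h.symm hlt hb, strictBetween_iff_above h hlt hb]
  · rw [strictBetween_iff_above h.symm hlt ha, strictBetween_iff_below h hlt ha]

theorem relpos_eq_one_iff {n : ℕ} {D U : Finset ℕ} (h : Split n D U) {a b : ℕ}
    (ha : a ≤ n + 2) (hb : b ≤ n + 2) (hab : a ≠ b) :
    relpos n D U a b = 1 ↔ ∀ v, ¬ StrictBetween n D U a b v := by
  have hpos : relpos n D U a b ≠ 0 := by
    intro h0
    apply hab
    apply pos_inj h ha hb
    have h1 := pos_lt_card h ha
    have h2 := pos_lt_card h hb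
    rw [relpos_eq h ha hb] at h0
    split_ifs at h0 <;> omega
  constructor
  · rintro h1 v ⟨-, hv1, hv2⟩
    omega
  · intro hno
    by_contra hne
    have h1 := pos_lt_card h ha
    obtain ⟨v, hv, hvp⟩ := exists_pos_eq h
      (p := if pos n D U a + 1 = n + 3 then 0 else pos n D U a + 1) (by split_ifs <;> omega)
    apply hno v
    have h2 : relpos n D U a v = 1 := by
      rw [relpos_eq h ha hv, hvp]
      split_ifs <;> omega
    exact ⟨hv, by omega, by omega⟩

theorem isBoundaryEdge_iff {n : ℕ} {D U : Finset ℕ} (h : Split n D U) (a b : ℕ) :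
    IsBoundaryEdge n D U (a, b) ↔ (a < b ∧ b ≤ n + 2) ∧
      ((∀ v, ¬ StrictBetween n D U a b v) ∨ ∀ v, ¬ StrictBetween n D U b a v) := by
  refine and_congr_right fun hd => ?_
  have hlt : a < b := hd.1
  have hb : b ≤ n + 2 := hd.2
  simp only
  rw [relpos_eq_one_iff h (by omega) hb (by omega), relpos_eq_one_iff h hb (by omega) (by omega)]

theorem isBoundaryEdge_swap {n : ℕ} {D U : Finset ℕ} (h : Split n D U) (δ : ℕ × ℕ) :
    IsBoundaryEdge n U D δ ↔ IsBoundaryEdge n D U δ := by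
  obtain ⟨a, b⟩ := δ
  rw [isBoundaryEdge_iff h, isBoundaryEdge_iff h.symm]
  refine and_congr_right fun hd => ?_
  simp only [strictBetween_swap h (a := a) (b := b) (by omega) (by omega) (by omega),
    strictBetween_swap h (a := b) (b := a) (by omega) (by omega) (by omega)]
  exact or_comm

theorem isInternalDiag_swap {n : ℕ} {D U : Finset ℕ} (h : Split n D U) (δ : ℕ × ℕ) :
    IsInternalDiag n U D δ ↔ IsInternalDiag n D U δ := by
  rw [IsInternalDiag, IsInternalDiag, isBoundaryEdge_swap h]

theorem cross_swap {n : ℕ} {D U : Finset ℕ} (h : Split n D U) {δ δ' : ℕ × ℕ}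
    (hδ : IsDiag n δ) : Cross n U D δ δ' ↔ Cross n D U δ δ' := by
  obtain ⟨h1, h2⟩ := hδ
  simp only [Cross, strictBetween_swap h (a := δ.1) (b := δ.2) (by omega) (by omega) (by omega),
    strictBetween_swap h (a := δ.2) (b := δ.1) (by omega) (by omega) (by omega)]
  tauto

theorem isTriangulation_swap {n : ℕ} {D U : Finset ℕ} (h : Split n D U)
    {T : Finset (ℕ × ℕ)} (hT : IsTriangulation n D U T) : IsTriangulation n U D T := by
  obtain ⟨h1, h2, h3⟩ := hT
  refine ⟨fun δ hδ => (isInternalDiag_swap h δ).2 (h1 δ hδ), fun δ hδ δ' hδ' hc => ?_,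
    fun δ hδ hnot => ?_⟩
  · exact h2 δ hδ δ' hδ' ((cross_swap h (h1 δ hδ).1).1 hc)
  · obtain ⟨δ', hδ', hc⟩ := h3 δ ((isInternalDiag_swap h δ).1 hδ) hnot
    exact ⟨δ', hδ', (cross_swap h hδ.1).2 hc⟩

theorem edgeOf_swap {n : ℕ} {D U : Finset ℕ} (h : Split n D U) (T : Finset (ℕ × ℕ))
    (a b : ℕ) : EdgeOf n U D T a b ↔ EdgeOf n D U T a b := by
  rw [EdgeOf, EdgeOf, isBoundaryEdge_swap h]

theorem isTriangleOf_swap {n : ℕ} {D U : Finset ℕ} (h : Split n D U) (T : Finset (ℕ × ℕ))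
    (i j k : ℕ) : IsTriangleOf n U D T i j k ↔ IsTriangleOf n D U T i j k := by
  simp only [IsTriangleOf, edgeOf_swap h]

theorem triWith_swap {n : ℕ} {D U : Finset ℕ} (h : Split n D U) (T : Finset (ℕ × ℕ))
    (δ : ℕ × ℕ) (c : ℕ) : TriWith n U D T δ c ↔ TriWith n D U T δ c := by
  simp only [TriWith, isTriangleOf_swap h]

theorem strictBetween_ne {n : ℕ} {D U : Finset ℕ} (h : Split n D U) {a b v : ℕ}
    (ha : a ≤ n + 2) (hb : b ≤ n + 2) (hv : StrictBetween n D U a b v) :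
    a ≠ v ∧ b ≠ v ∧ a ≠ b := by
  rw [strictBetween_iff_pos h ha hb] at hv
  refine ⟨?_, ?_, ?_⟩ <;> rintro rfl <;> omega

theorem strictBetween_symm_of_crossing {n : ℕ} {D U : Finset ℕ} (h : Split n D U)
    {x y z w : ℕ} (hx : x ≤ n + 2) (hy : y ≤ n + 2) (hz : StrictBetween n D U x y z)
    (hw : StrictBetween n D U y x w) :
    StrictBetween n D U z w y ∧ StrictBetween n D U w z x := by
  have hz' := hz.1
  have hw' := hw.1
  rw [strictBetween_iff_pos h hx hy] at hz
  rw [strictBetween_iff_pos h hy hx] at hw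
  rw [strictBetween_iff_pos h hz' hw', strictBetween_iff_pos h hw' hz']
  omega

/-- `x` and `y`, in either order, are joined by a diagonal of `T` or a boundary edge. -/
def Joined (n : ℕ) (D U : Finset ℕ) (T : Finset (ℕ × ℕ)) (x y : ℕ) : Prop :=
  EdgeOf n D U T x y ∨ EdgeOf n D U T y x

theorem Joined.symm {n : ℕ} {D U : Finset ℕ} {T : Finset (ℕ × ℕ)} {x y : ℕ}
    (hj : Joined n D U T x y) : Joined n D U T y x := Or.symm hj

theorem edgeOf_isDiag {n : ℕ} {D U : Finset ℕ} {T : Finset (ℕ × ℕ)}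
    (hT : IsTriangulation n D U T) {x y : ℕ} (he : EdgeOf n D U T x y) : x < y ∧ y ≤ n + 2 := by
  rcases he with he | he
  · exact (hT.1 _ he).1
  · exact he.1

theorem Joined.le {n : ℕ} {D U : Finset ℕ} {T : Finset (ℕ × ℕ)}
    (hT : IsTriangulation n D U T) {x y : ℕ} (hj : Joined n D U T x y) :
    x ≤ n + 2 ∧ y ≤ n + 2 ∧ x ≠ y := by
  rcases hj with hj | hj <;> have := edgeOf_isDiag hT hj <;> omega

theorem Joined.edgeOf {n : ℕ} {D U : Finset ℕ} {T : Finset (ℕ × ℕ)}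
    (hT : IsTriangulation n D U T) {x y : ℕ} (hj : Joined n D U T x y) (hxy : x < y) :
    EdgeOf n D U T x y := by
  rcases hj with hj | hj
  · exact hj
  · have := edgeOf_isDiag hT hj
    omega

theorem Joined.mem_or_boundary {n : ℕ} {D U : Finset ℕ} {T : Finset (ℕ × ℕ)}
    (h : Split n D U) {x y : ℕ} (hj : Joined n D U T x y) :
    (x, y) ∈ T ∨ (y, x) ∈ T ∨ (∀ v, ¬ StrictBetween n D U x y v) ∨
      ∀ v, ¬ StrictBetween n D U y x v := by
  rcases hj with (hj | hj) | (hj | hj)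
  · exact Or.inl hj
  · exact Or.inr (Or.inr ((isBoundaryEdge_iff h _ _).1 hj).2)
  · exact Or.inr (Or.inl hj)
  · exact Or.inr (Or.inr ((isBoundaryEdge_iff h _ _).1 hj).2.symm)

theorem Joined.not_crossing {n : ℕ} {D U : Finset ℕ} {T : Finset (ℕ × ℕ)}
    (h : Split n D U) (hT : IsTriangulation n D U T) {x y z w : ℕ}
    (hxy : Joined n D U T x y) (hzw : Joined n D U T z w)
    (hz : StrictBetween n D U x y z) (hw : StrictBetween n D U y x w) : False := by
  obtain ⟨hx, hy, hne⟩ := hxy.le hT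
  obtain ⟨hz', hw', hne'⟩ := hzw.le hT
  obtain ⟨hy2, hx2⟩ := strictBetween_symm_of_crossing h hx hy hz hw
  obtain ⟨n1, n2, -⟩ := strictBetween_ne h hx hy hz
  obtain ⟨n3, n4, -⟩ := strictBetween_ne h hy hx hw
  rcases hxy.mem_or_boundary h with h1 | h1 | h1 | h1
  · rcases hzw.mem_or_boundary h with h2 | h2 | h2 | h2
    · exact hT.2.1 _ h1 _ h2 ⟨hne, hne', n1, n4, n2, n3, Or.inl ⟨hz, hw⟩⟩
    · exact hT.2.1 _ h1 _ h2 ⟨hne, hne'.symm, n4, n1, n3, n2, Or.inr ⟨hz, hw⟩⟩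
    · exact h2 _ hy2
    · exact h2 _ hx2
  · rcases hzw.mem_or_boundary h with h2 | h2 | h2 | h2
    · exact hT.2.1 _ h1 _ h2 ⟨hne.symm, hne', n2, n3, n1, n4, Or.inr ⟨hw, hz⟩⟩
    · exact hT.2.1 _ h1 _ h2 ⟨hne.symm, hne'.symm, n3, n2, n4, n1, Or.inl ⟨hw, hz⟩⟩
    · exact h2 _ hy2
    · exact h2 _ hx2
  · exact h1 _ hz
  · exact h1 _ hw

theorem edgeOf_of_not_crossing {n : ℕ} {D U : Finset ℕ} {T : Finset (ℕ × ℕ)}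
    (hT : IsTriangulation n D U T) {x y : ℕ} (hxy : x < y) (hy : y ≤ n + 2)
    (hno : ∀ z w, Joined n D U T z w → StrictBetween n D U x y z →
      StrictBetween n D U y x w → False) : EdgeOf n D U T x y := by
  by_contra hne
  rw [EdgeOf, not_or] at hne
  obtain ⟨δ', hδ', hc⟩ := hT.2.2 (x, y) ⟨⟨hxy, hy⟩, hne.2⟩ hne.1
  obtain ⟨-, -, -, -, -, -, ⟨h1, h2⟩ | ⟨h1, h2⟩⟩ := hc
  · exact hno _ _ (Or.inl (Or.inl hδ')) h1 h2
  · exact hno _ _ (Or.inr (Or.inl hδ')) h1 h2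

theorem joined_of_not_crossing {n : ℕ} {D U : Finset ℕ} {T : Finset (ℕ × ℕ)}
    (hT : IsTriangulation n D U T) {x y : ℕ} (hx : x ≤ n + 2) (hy : y ≤ n + 2) (hxy : x ≠ y)
    (hno : ∀ z w, Joined n D U T z w → StrictBetween n D U x y z →
      StrictBetween n D U y x w → False) : Joined n D U T x y := by
  rcases lt_or_gt_of_ne hxy with hlt | hlt
  · exact Or.inl (edgeOf_of_not_crossing hT hlt hy hno)
  · exact Or.inr (edgeOf_of_not_crossing hT hlt hx fun z w hj h1 h2 => hno w z hj.symm h2 h1)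

theorem exists_apex {n : ℕ} {D U : Finset ℕ} {T : Finset (ℕ × ℕ)}
    (h : Split n D U) (hT : IsTriangulation n D U T) {a b : ℕ} (hab : Joined n D U T a b)
    (hv : ∃ v, StrictBetween n D U a b v) :
    ∃ c, StrictBetween n D U a b c ∧ Joined n D U T a c ∧ Joined n D U T c b := by
  obtain ⟨ha, hb, hne⟩ := hab.le hT
  have hpa := pos_lt_card h ha
  have hpb := pos_lt_card h hb
  set S := (Finset.range (n + 3)).filter
    (fun c => StrictBetween n D U a b c ∧ Joined n D U T a c) with hS
  have hSne : S.Nonempty := by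
    obtain ⟨w, hw⟩ := hv
    obtain ⟨v, hvn, hvp⟩ := exists_pos_eq h
      (p := if pos n D U a + 1 = n + 3 then 0 else pos n D U a + 1) (by split_ifs <;> omega)
    have hav : a ≠ v := by
      rintro rfl
      split_ifs at hvp <;> omega
    refine ⟨v, Finset.mem_filter.2 ⟨Finset.mem_range.2 (by omega), ?_, ?_⟩⟩
    · have hw' := hw.1
      have hpw := pos_lt_card h hw'
      have hvb : v ≠ b := by
        rintro rfl
        rw [strictBetween_iff_pos h ha hb] at hw
        split_ifs at hvp <;> omega
      have hvb' : pos n D U v ≠ pos n D U b := fun he => hvb (pos_inj h hvn hb he)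
      rw [strictBetween_iff_pos h ha hb] at hw ⊢
      split_ifs at hvp <;> omega
    · apply joined_of_not_crossing hT ha hvn hav
      intro z w' _ hz _
      have hz' := hz.1
      have hpz := pos_lt_card h hz'
      rw [strictBetween_iff_pos h ha hvn] at hz
      split_ifs at hvp <;> omega
  obtain ⟨c, hcS, hmax⟩ := Finset.exists_max_image S (fun c => relpos n D U a c) hSne
  obtain ⟨-, hc, hac⟩ := Finset.mem_filter.1 hcS
  have hcn := hc.1
  have hpc := pos_lt_card h hcn
  obtain ⟨n1, n2, -⟩ := strictBetween_ne h ha hb hc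
  refine ⟨c, hc, hac, joined_of_not_crossing hT hcn hb n2.symm ?_⟩
  intro z w hzw hz hw
  obtain ⟨hzn, hwn, hzwne⟩ := hzw.le hT
  have hpz := pos_lt_card h hzn
  have hpw := pos_lt_card h hwn
  have hcc := (strictBetween_iff_pos h ha hb).1 hc
  have hzz := (strictBetween_iff_pos h hcn hb).1 hz
  have hww := (strictBetween_iff_pos h hb hcn).1 hw
  have habz : StrictBetween n D U a b z := (strictBetween_iff_pos h ha hb).2 (by omega)
  by_cases hwa : w = a
  · subst hwa
    have hmz := hmax z (Finset.mem_filter.2 ⟨Finset.mem_range.2 (by omega), habz, hzw.symm⟩)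
    simp only [relpos_eq h ha hzn, relpos_eq h ha hcn] at hmz
    split_ifs at hmz <;> omega
  have hwa' : pos n D U w ≠ pos n D U a := fun he => hwa (pos_inj h hwn ha he)
  by_cases hbaw : StrictBetween n D U b a w
  · exact hab.not_crossing h hT hzw habz hbaw
  · rw [strictBetween_iff_pos h hb ha] at hbaw
    exact hac.not_crossing h hT hzw.symm ((strictBetween_iff_pos h ha hcn).2 (by omega))
      ((strictBetween_iff_pos h hcn ha).2 (by omega))

theorem isInternalDiag_iff {n : ℕ} {D U : Finset ℕ} (h : Split n D U) (a b : ℕ) :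
    IsInternalDiag n D U (a, b) ↔
      (a < b ∧ b ≤ n + 2) ∧ (∃ v, Below n D U a b v) ∧ ∃ v, Below n U D a b v := by
  rw [IsInternalDiag, isBoundaryEdge_iff h]
  refine and_congr_right fun hd => ?_
  have hlt : a < b := hd.1
  have hb : b ≤ n + 2 := hd.2
  simp only [strictBetween_iff_below h hlt hb, strictBetween_iff_above h hlt hb, hlt, hb,
    true_and, not_or, not_forall, not_not, and_self]

theorem below_or_above {n : ℕ} {D U : Finset ℕ} (h : Split n D U) {a b v : ℕ}
    (hab : a < b) (hb : b ≤ n + 2) (hv : v ≤ n + 2) (hva : v ≠ a) (hvb : v ≠ b) :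
    Below n D U a b v ∨ Below n U D a b v := by
  have hm := h.mem_or
  have h1 := hm a
  have h2 := hm b
  have h3 := hm v
  simp only [Below]
  rcases lt_or_gt_of_ne hva with hlt | hlt
  · rcases h1.2 (by omega) with h1 | h1
    · exact Or.inr ⟨hv, Or.inr (Or.inl ⟨hlt, h1⟩)⟩
    · exact Or.inl ⟨hv, Or.inr (Or.inl ⟨hlt, h1⟩)⟩
  · rcases lt_or_gt_of_ne hvb with hlt' | hlt'
    · rcases h3.2 (by omega) with h3 | h3
      · exact Or.inl ⟨hv, Or.inl ⟨hlt, hlt', h3⟩⟩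
      · exact Or.inr ⟨hv, Or.inl ⟨hlt, hlt', h3⟩⟩
    · rcases h2.2 (by omega) with h2 | h2
      · exact Or.inr ⟨hv, Or.inr (Or.inr ⟨hlt', h2⟩)⟩
      · exact Or.inl ⟨hv, Or.inr (Or.inr ⟨hlt', h2⟩)⟩

theorem not_below_and_above {n : ℕ} {D U : Finset ℕ} (h : Split n D U) {a b v : ℕ}
    (hab : a < b) (h1 : Below n D U a b v) (h2 : Below n U D a b v) : False := by
  have ha := h.not_both a
  have hb := h.not_both b
  have hv := h.not_both v
  obtain ⟨-, h1⟩ := h1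
  obtain ⟨-, h2⟩ := h2
  rcases h1 with h1 | h1 | h1 <;> rcases h2 with h2 | h2 | h2 <;> first | omega | tauto

theorem Below.ne {n : ℕ} {D U : Finset ℕ} {a b v : ℕ} (hab : a < b)
    (h1 : Below n D U a b v) : v ≠ a ∧ v ≠ b := by
  obtain ⟨-, h1⟩ := h1
  omega

theorem triWith_iff {n : ℕ} {D U T : _} {a b c : ℕ} : TriWith n D U T (a, b) c ↔
    (c < a ∧ IsTriangleOf n D U T c a b) ∨ (a < c ∧ c < b ∧ IsTriangleOf n D U T a c b) ∨
      (b < c ∧ IsTriangleOf n D U T a b c) := by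
  simp only [TriWith, IsTriangleOf]
  split_ifs with h1 h2
  · constructor
    · intro h; exact Or.inl ⟨h1, h⟩
    · rintro (h | h | h)
      · exact h.2
      · omega
      · omega
  · constructor
    · intro h; exact Or.inr (Or.inl ⟨h.1, h2, h⟩)
    · rintro (h | h | h)
      · omega
      · exact h.2.2
      · omega
  · constructor
    · intro h; exact Or.inr (Or.inr ⟨h.2.1, h⟩)
    · rintro (h | h | h)
      · omega
      · omega
      · exact h.2

theorem triWith_of_joined {n : ℕ} {D U : Finset ℕ} {T : Finset (ℕ × ℕ)}
    (hT : IsTriangulation n D U T) {a b c : ℕ} (he : EdgeOf n D U T a b)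
    (hac : Joined n D U T a c) (hcb : Joined n D U T c b) : TriWith n D U T (a, b) c := by
  obtain ⟨hab, hb⟩ := edgeOf_isDiag hT he
  obtain ⟨-, hc, hne⟩ := hac.le hT
  obtain ⟨-, -, hne'⟩ := hcb.le hT
  rw [triWith_iff]
  rcases lt_or_gt_of_ne hne with h1 | h1
  · rcases lt_or_gt_of_ne hne' with h2 | h2
    · exact Or.inr (Or.inl ⟨h1, h2, h1, h2, hb, hac.edgeOf hT h1, hcb.edgeOf hT h2, he⟩)
    · exact Or.inr (Or.inr ⟨h2, hab, h2, hc, he, hcb.symm.edgeOf hT h2, hac.edgeOf hT h1⟩)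
  · exact Or.inl ⟨h1, h1, hab, hb, hac.symm.edgeOf hT h1, he, hcb.edgeOf hT (by omega)⟩

theorem TriWith.joined {n : ℕ} {D U : Finset ℕ} {T : Finset (ℕ × ℕ)} {a b c : ℕ}
    (ht : TriWith n D U T (a, b) c) :
    EdgeOf n D U T a b ∧ Joined n D U T a c ∧ Joined n D U T c b := by
  rw [triWith_iff] at ht
  rcases ht with ⟨-, -, -, -, h1, h2, h3⟩ | ⟨-, -, -, -, -, h1, h2, h3⟩ |
    ⟨-, -, -, -, h1, h2, h3⟩
  · exact ⟨h2, Or.inr h1, Or.inl h3⟩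
  · exact ⟨h3, Or.inl h1, Or.inl h2⟩
  · exact ⟨h1, Or.inl h3, Or.inr h2⟩

theorem exists_triWith_below {n : ℕ} {D U : Finset ℕ} {T : Finset (ℕ × ℕ)}
    (h : Split n D U) (hT : IsTriangulation n D U T) {a b : ℕ} (he : EdgeOf n D U T a b)
    (hv : ∃ v, Below n D U a b v) : ∃ c, Below n D U a b c ∧ TriWith n D U T (a, b) c := by
  obtain ⟨hab, hb⟩ := edgeOf_isDiag hT he
  simp only [← strictBetween_iff_below h hab hb] at hv ⊢
  obtain ⟨c, hc, h1, h2⟩ := exists_apex h hT (Or.inl he) hv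
  exact ⟨c, hc, triWith_of_joined hT he h1 h2⟩

theorem exists_triWith_above {n : ℕ} {D U : Finset ℕ} {T : Finset (ℕ × ℕ)}
    (h : Split n D U) (hT : IsTriangulation n D U T) {a b : ℕ} (he : EdgeOf n D U T a b)
    (hv : ∃ v, Below n U D a b v) : ∃ c, Below n U D a b c ∧ TriWith n D U T (a, b) c := by
  obtain ⟨c, hc, ht⟩ := exists_triWith_below h.symm (isTriangulation_swap h hT)
    ((edgeOf_swap h T a b).2 he) hv
  exact ⟨c, hc, (triWith_swap h T _ c).1 ht⟩

theorem EdgeOf.not_crossing {n : ℕ} {D U : Finset ℕ} {T : Finset (ℕ × ℕ)}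
    (h : Split n D U) (hT : IsTriangulation n D U T) {a b z w : ℕ} (he : EdgeOf n D U T a b)
    (hzw : Joined n D U T z w) (hz : Below n D U a b z) (hw : Below n U D a b w) : False := by
  obtain ⟨hab, hb⟩ := edgeOf_isDiag hT he
  exact Joined.not_crossing h hT (Or.inl he) hzw ((strictBetween_iff_below h hab hb z).2 hz)
    ((strictBetween_iff_above h hab hb w).2 hw)

theorem TriWith.below_unique {n : ℕ} {D U : Finset ℕ} {T : Finset (ℕ × ℕ)}
    (h : Split n D U) (hT : IsTriangulation n D U T) {a b c c' : ℕ}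
    (ht : TriWith n D U T (a, b) c) (ht' : TriWith n D U T (a, b) c')
    (hc : Below n D U a b c) (hc' : Below n D U a b c') : c = c' := by
  obtain ⟨he, h1, h2⟩ := ht.joined
  obtain ⟨-, h1', h2'⟩ := ht'.joined
  obtain ⟨hab, hb⟩ := edgeOf_isDiag hT he
  have ha : a ≤ n + 2 := by omega
  rw [← strictBetween_iff_below h hab hb] at hc hc'
  have hcn := hc.1
  have hcn' := hc'.1
  by_contra hne
  have hp : pos n D U c ≠ pos n D U c' := fun hp => hne (pos_inj h hcn hcn' hp)
  rw [strictBetween_iff_pos h ha hb] at hc hc'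
  by_cases hs : StrictBetween n D U a c' c
  · refine h1'.not_crossing h hT h2 hs ?_
    rw [strictBetween_iff_pos h ha hcn'] at hs
    rw [strictBetween_iff_pos h hcn' ha]
    omega
  · rw [strictBetween_iff_pos h ha hcn'] at hs
    refine h1.not_crossing h hT h2' ?_ ?_
    · rw [strictBetween_iff_pos h ha hcn]
      omega
    · rw [strictBetween_iff_pos h hcn ha]
      omega

theorem TriWith.above_unique {n : ℕ} {D U : Finset ℕ} {T : Finset (ℕ × ℕ)}
    (h : Split n D U) (hT : IsTriangulation n D U T) {a b c c' : ℕ}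
    (ht : TriWith n D U T (a, b) c) (ht' : TriWith n D U T (a, b) c')
    (hc : Below n U D a b c) (hc' : Below n U D a b c') : c = c' :=
  TriWith.below_unique h.symm (isTriangulation_swap h hT) ((triWith_swap h T _ c).2 ht)
    ((triWith_swap h T _ c').2 ht') hc hc'

theorem spineSrc_eq {n : ℕ} {D U : Finset ℕ} {T : Finset (ℕ × ℕ)}
    (h : Split n D U) (hT : IsTriangulation n D U T) {a b c : ℕ}
    (ht : TriWith n D U T (a, b) c) (hc : Below n D U a b c) :
    spineSrc n D U T (a, b) = midOf a b c := by
  obtain ⟨hab, hb⟩ := edgeOf_isDiag hT ht.joined.1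
  have hex : ∃ c, StrictBetween n D U a b c ∧ TriWith n D U T (a, b) c :=
    ⟨c, (strictBetween_iff_below h hab hb c).2 hc, ht⟩
  rw [spineSrc, dif_pos hex, TriWith.below_unique h hT hex.choose_spec.2 ht
    ((strictBetween_iff_below h hab hb _).1 hex.choose_spec.1) hc]

theorem spineTgt_eq {n : ℕ} {D U : Finset ℕ} {T : Finset (ℕ × ℕ)}
    (h : Split n D U) (hT : IsTriangulation n D U T) {a b c : ℕ}
    (ht : TriWith n D U T (a, b) c) (hc : Below n U D a b c) :
    spineTgt n D U T (a, b) = midOf a b c := by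
  obtain ⟨hab, hb⟩ := edgeOf_isDiag hT ht.joined.1
  have hex : ∃ c, StrictBetween n D U b a c ∧ TriWith n D U T (a, b) c :=
    ⟨c, (strictBetween_iff_above h hab hb c).2 hc, ht⟩
  rw [spineTgt, dif_pos hex, TriWith.above_unique h hT hex.choose_spec.2 ht
    ((strictBetween_iff_above h hab hb _).1 hex.choose_spec.1) hc]

/-- `f` is strictly increasing along the arcs of the spine of `T`, each arc being given by the
two triangles adjacent to a diagonal. -/
def IncreasesOnSpine (n : ℕ) (D U : Finset ℕ) (T : Finset (ℕ × ℕ)) (f : ℕ → ℤ) : Prop :=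
  ∀ a b c c', Below n D U a b c → Below n U D a b c' → TriWith n D U T (a, b) c →
    TriWith n D U T (a, b) c' → f (midOf a b c) < f (midOf a b c')

theorem IncreasesOnSpine.swap {n : ℕ} {D U : Finset ℕ} {T : Finset (ℕ × ℕ)} {f : ℕ → ℤ}
    (h : Split n D U) (hf : IncreasesOnSpine n D U T f) :
    IncreasesOnSpine n U D T (fun j => - f j) := by
  intro a b c c' hc hc' ht ht'
  exact neg_lt_neg (hf a b c' c hc' hc ((triWith_swap h T _ _).1 ht')
    ((triWith_swap h T _ _).1 ht))

theorem EdgeOf.mem_of_below_of_above {n : ℕ} {D U : Finset ℕ} {T : Finset (ℕ × ℕ)}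
    (h : Split n D U) {a b c c' : ℕ} (he : EdgeOf n D U T a b) (hc : Below n D U a b c)
    (hc' : Below n U D a b c') : (a, b) ∈ T := by
  rcases he with he | he
  · exact he
  · exact absurd he ((isInternalDiag_iff h a b).2 ⟨he.1, ⟨c, hc⟩, ⟨c', hc'⟩⟩).2

theorem increasesOnSpine_iff {n : ℕ} {D U : Finset ℕ} {T : Finset (ℕ × ℕ)} (h : Split n D U)
    (hT : IsTriangulation n D U T) (f : ℕ → ℤ) : IncreasesOnSpine n D U T f ↔
      ∀ δ ∈ T, f (spineSrc n D U T δ) < f (spineTgt n D U T δ) := by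
  constructor
  · rintro hf ⟨a, b⟩ hδ
    obtain ⟨-, hv, hv'⟩ := (isInternalDiag_iff h a b).1 (hT.1 _ hδ)
    obtain ⟨c, hc, ht⟩ := exists_triWith_below h hT (Or.inl hδ) hv
    obtain ⟨c', hc', ht'⟩ := exists_triWith_above h hT (Or.inl hδ) hv'
    rw [spineSrc_eq h hT ht hc, spineTgt_eq h hT ht' hc']
    exact hf a b c c' hc hc' ht ht'
  · intro hf a b c c' hc hc' ht ht'
    rw [← spineSrc_eq h hT ht hc, ← spineTgt_eq h hT ht' hc']
    exact hf _ (ht.joined.1.mem_of_below_of_above h hc hc')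

/-- `l` is a label weakly between `a` and `b` that belongs to `Bel {a,b}`; exchanging `D` and
`U` gives the labels weakly between `a` and `b` outside `Bel {a,b}`. -/
def Lower (D U : Finset ℕ) (a b l : ℕ) : Prop :=
  (a < l ∧ l < b ∧ l ∈ D) ∨ (l ∈ U ∧ (l = a ∨ l = b))

theorem Lower.exists_below {n : ℕ} {D U : Finset ℕ} (h : Split n D U) {a b l : ℕ}
    (hab : a < b) (hl : Lower D U a b l) : ∃ v, Below n D U a b v := by
  have hm := h.mem_or l
  rcases hl with hl | ⟨hl, rfl | rfl⟩
  · exact ⟨l, by have := hm.1 (Or.inl hl.2.2); omega, Or.inl hl⟩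
  · exact ⟨0, by omega, Or.inr (Or.inl ⟨by have := hm.1 (Or.inr hl); omega, hl⟩)⟩
  · exact ⟨n + 2, by omega, Or.inr (Or.inr ⟨by have := hm.1 (Or.inr hl); omega, hl⟩)⟩

theorem lower_lt_of_forall {n : ℕ} {D U : Finset ℕ} {T : Finset (ℕ × ℕ)} {f : ℕ → ℤ}
    (h : Split n D U) (hT : IsTriangulation n D U T) (hf : IncreasesOnSpine n D U T f)
    {a b t l : ℕ} (ht : Below n U D a b t) (htri : TriWith n D U T (a, b) t)
    (hl : Lower D U a b l)
    (ih : ∀ i j k l, IsTriangleOf n D U T i j k → f j < f (midOf a b t) → Lower D U i k l →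
      l ≠ j → f l < f j) : f l < f (midOf a b t) := by
  have he := htri.joined.1
  obtain ⟨hab, hb⟩ := edgeOf_isDiag hT he
  obtain ⟨c, hc, hctri⟩ := exists_triWith_below h hT he (hl.exists_below h hab)
  have hlt := hf a b c t hc ht hctri htri
  by_cases hlc : l = midOf a b c
  · rwa [hlc]
  have hd := h.not_both
  have hda := hd a
  have hdb := hd b
  have hdl := hd l
  obtain ⟨-, hc⟩ := hc
  refine lt_trans ?_ hlt
  rw [triWith_iff] at hctri
  rcases hctri with ⟨h1, h2⟩ | ⟨h1, h1', h2⟩ | ⟨h1, h2⟩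
  · have hmid : midOf a b c = a := by rw [midOf, if_pos h1]
    rw [hmid] at hlc hlt ⊢
    refine ih _ _ _ l h2 hlt ?_ hlc
    rcases hl with hl | ⟨hl, rfl | rfl⟩
    · exact Or.inl ⟨by omega, hl.2⟩
    · exact absurd rfl hlc
    · exact Or.inr ⟨hl, Or.inr rfl⟩
  · have hmid : midOf a b c = c := by rw [midOf, if_neg (by omega), if_pos h1']
    rw [hmid] at hlc hlt ⊢
    exact ih _ _ _ l h2 hlt hl hlc
  · have hmid : midOf a b c = b := by rw [midOf, if_neg (by omega), if_neg (by omega)]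
    rw [hmid] at hlc hlt ⊢
    refine ih _ _ _ l h2 hlt ?_ hlc
    rcases hl with hl | ⟨hl, rfl | rfl⟩
    · exact Or.inl ⟨hl.1, by omega, hl.2.2⟩
    · exact Or.inr ⟨hl, Or.inl rfl⟩
    · exact absurd rfl hlc

theorem IsTriangleOf.lower_lt {n : ℕ} {D U : Finset ℕ} {T : Finset (ℕ × ℕ)} {f : ℕ → ℤ}
    (h : Split n D U) (hT : IsTriangulation n D U T) (hf : IncreasesOnSpine n D U T f)
    {i j k l : ℕ} (htri : IsTriangleOf n D U T i j k) (hl : Lower D U i k l) (hlj : l ≠ j) :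
    f l < f j := by
  induction hN : ((Finset.Icc 1 (n + 1)).filter (fun m => f m < f j)).card using
    Nat.strong_induction_on generalizing i j k l with
  | _ N IH =>
    obtain ⟨hij, hjk, hk, e1, e2, e3⟩ := htri
    have ih : ∀ i' j' k' l', IsTriangleOf n D U T i' j' k' → f j' < f j → Lower D U i' k' l' →
        l' ≠ j' → f l' < f j' := by
      intro i' j' k' l' ht' hlt hl' hne
      refine IH _ ?_ ht' hl' hne rfl
      rw [← hN]
      apply Finset.card_lt_card
      have hj' : 1 ≤ j' ∧ j' ≤ n + 1 := by
        have := ht'.1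
        have := ht'.2.1
        have := ht'.2.2.1
        omega
      refine Finset.ssubset_iff_of_subset ?_ |>.2 ⟨j', ?_, ?_⟩
      · intro x
        simp only [Finset.mem_filter]
        exact fun hx => ⟨hx.1, hx.2.trans hlt⟩
      · simp only [Finset.mem_filter, Finset.mem_Icc]
        exact ⟨hj', hlt⟩
      · simp
    have hjm := (h.mem_or j).2 (by omega)
    have hdj := h.not_both j
    rcases hjm with hj | hj
    · by_cases hlt : l < j
      · have hmid : midOf i j k = j := by rw [midOf, if_neg (by omega), if_neg (by omega)]
        have := lower_lt_of_forall (a := i) (b := j) (t := k) (l := l) h hT hf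
          ⟨hk, Or.inr (Or.inr ⟨hjk, hj⟩)⟩
          (triWith_iff.2 (Or.inr (Or.inr ⟨hjk, hij, hjk, hk, e1, e2, e3⟩)))
          (by
            rcases hl with hl | ⟨hl, hl'⟩
            · exact Or.inl ⟨hl.1, hlt, hl.2.2⟩
            · exact Or.inr ⟨hl, Or.inl (by omega)⟩)
          (by rwa [hmid])
        rwa [hmid] at this
      · have hmid : midOf j k i = j := by rw [midOf, if_pos hij]
        have := lower_lt_of_forall (a := j) (b := k) (t := i) (l := l) h hT hf
          ⟨by omega, Or.inr (Or.inl ⟨hij, hj⟩)⟩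
          (triWith_iff.2 (Or.inl ⟨hij, hij, hjk, hk, e1, e2, e3⟩))
          (by
            rcases hl with hl | ⟨hl, hl'⟩
            · exact Or.inl ⟨by omega, hl.2⟩
            · exact Or.inr ⟨hl, Or.inr (by omega)⟩)
          (by rwa [hmid])
        rwa [hmid] at this
    · have hmid : midOf i k j = j := by rw [midOf, if_neg (by omega), if_pos hjk]
      have := lower_lt_of_forall (a := i) (b := k) (t := j) (l := l) h hT hf
        ⟨by omega, Or.inl ⟨hij, hjk, hj⟩⟩
        (triWith_iff.2 (Or.inr (Or.inl ⟨hij, hjk, hij, hjk, hk, e1, e2, e3⟩))) hl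
        (by rwa [hmid])
      rwa [hmid] at this

theorem IsTriangleOf.lt_upper {n : ℕ} {D U : Finset ℕ} {T : Finset (ℕ × ℕ)} {f : ℕ → ℤ}
    (h : Split n D U) (hT : IsTriangulation n D U T) (hf : IncreasesOnSpine n D U T f)
    {i j k l : ℕ} (htri : IsTriangleOf n D U T i j k) (hl : Lower U D i k l) (hlj : l ≠ j) :
    f j < f l :=
  neg_lt_neg_iff.1 (IsTriangleOf.lower_lt h.symm (isTriangulation_swap h hT) (hf.swap h)
    ((isTriangleOf_swap h T i j k).2 htri) hl hlj)

theorem cross_iff {n : ℕ} {D U : Finset ℕ} (h : Split n D U) {a b c d : ℕ} (hab : a < b)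
    (hb : b ≤ n + 2) (hcd : c ≠ d) : Cross n D U (a, b) (c, d) ↔
      (Below n D U a b c ∧ Below n U D a b d) ∨ (Below n D U a b d ∧ Below n U D a b c) := by
  simp only [Cross, strictBetween_iff_below h hab hb, strictBetween_iff_above h hab hb]
  constructor
  · rintro ⟨-, -, -, -, -, -, hc⟩
    exact hc
  · intro hc
    refine ⟨by omega, hcd, ?_, ?_, ?_, ?_, hc⟩ <;>
    · rcases hc with ⟨h1, h2⟩ | ⟨h1, h2⟩ <;>
      · have := h1.ne hab
        have := h2.ne hab
        omega

/-- Every label of `Lower D U a b` comes before every label of `Lower U D a b`. -/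
def Separates (D U : Finset ℕ) (f : ℕ → ℤ) (a b : ℕ) : Prop :=
  ∀ l m, Lower D U a b l → Lower U D a b m → f l < f m

theorem Separates.swap {D U : Finset ℕ} {f : ℕ → ℤ} {a b : ℕ} (hs : Separates D U f a b) :
    Separates U D (fun j => - f j) a b :=
  fun l m hl hm => neg_lt_neg (hs m l hm hl)

theorem Separates.not_crossing {n : ℕ} {D U : Finset ℕ} (h : Split n D U) {f : ℕ → ℤ}
    {a b c d : ℕ} (hab : a < b) (hcd : c < d) (hs : Separates D U f a b)
    (hs' : Separates D U f c d) (hc : Below n D U a b c) (hd : Below n U D a b d) : False := by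
  have hda := h.not_both a
  have hdb := h.not_both b
  obtain ⟨-, hc | hc | hc⟩ := hc <;> obtain ⟨-, hd | hd | hd⟩ := hd
  · exact lt_asymm (hs c d (Or.inl hc) (Or.inl hd))
      (hs' d c (Or.inr ⟨hd.2.2, Or.inr rfl⟩) (Or.inr ⟨hc.2.2, Or.inl rfl⟩))
  · omega
  · exact lt_asymm (hs c b (Or.inl hc) (Or.inr ⟨hd.2, Or.inr rfl⟩))
      (hs' b c (Or.inl ⟨hc.2.1, hd⟩) (Or.inr ⟨hc.2.2, Or.inl rfl⟩))
  · exact lt_asymm (hs a d (Or.inr ⟨hc.2, Or.inl rfl⟩) (Or.inl hd))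
      (hs' d a (Or.inr ⟨hd.2.2, Or.inr rfl⟩) (Or.inl ⟨hc.1, hd.1, hc.2⟩))
  · exact hda hd.2 hc.2
  · exact lt_asymm (hs a b (Or.inr ⟨hc.2, Or.inl rfl⟩) (Or.inr ⟨hd.2, Or.inr rfl⟩))
      (hs' b a (Or.inl ⟨by omega, hd.1, hd.2⟩) (Or.inl ⟨hc.1, by omega, hc.2⟩))
  · omega
  · omega
  · exact hdb hd.2 hc.2

/-- The triangulation obtained from the order of the labels given by `f`. -/
def orderTriangulation (n : ℕ) (D U : Finset ℕ) (f : ℕ → ℤ) : Finset (ℕ × ℕ) :=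
  (Finset.range (n + 3) ×ˢ Finset.range (n + 3)).filter
    (fun δ => IsInternalDiag n D U δ ∧ Separates D U f δ.1 δ.2)

theorem mem_orderTriangulation {n : ℕ} {D U : Finset ℕ} {f : ℕ → ℤ} {δ : ℕ × ℕ} :
    δ ∈ orderTriangulation n D U f ↔ IsInternalDiag n D U δ ∧ Separates D U f δ.1 δ.2 := by
  rw [orderTriangulation, Finset.mem_filter, and_iff_right_iff_imp, Finset.mem_product,
    Finset.mem_range, Finset.mem_range]
  rintro ⟨⟨⟨h1, h2⟩, -⟩, -⟩
  omega

theorem exists_separates_crossing {n : ℕ} {D U : Finset ℕ} (h : Split n D U) {f : ℕ → ℤ}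
    {a b l m : ℕ} (hab : a < b) (hb : b ≤ n + 2) (hl : Lower D U a b l)
    (hm : Lower U D a b m) (hlm : l < m) (hf : f m < f l) :
    ∃ c d, c < d ∧ d ≤ n + 2 ∧ Separates D U f c d ∧ Below n D U a b c ∧ Below n U D a b d := by
  have hnb := h.not_both
  have hmem := h.mem_or
  set V := (Finset.range (n + 3)).filter (fun v => v = 0 ∨ v = n + 2 ∨ (v ∈ D ∧ f l ≤ f v) ∨
    (v ∈ U ∧ f v < f l)) with hV
  have hVmem : ∀ v, v ∈ V ↔ v < n + 3 ∧ (v = 0 ∨ v = n + 2 ∨ (v ∈ D ∧ f l ≤ f v) ∨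
    (v ∈ U ∧ f v < f l)) := fun v => by rw [hV, Finset.mem_filter, Finset.mem_range]
  have hl1 : 1 ≤ l ∧ l ≤ n + 1 := (hmem l).1 (by rcases hl with hl | hl <;> tauto)
  have hm1 : 1 ≤ m ∧ m ≤ n + 1 := (hmem m).1 (by rcases hm with hm | hm <;> tauto)
  obtain ⟨c, hc, hcmax⟩ := Finset.exists_max_image
    (V.filter (fun v => v < m ∧ ¬ (a < v ∧ v ∈ U))) id
    ⟨0, by
      simp only [Finset.mem_filter, hVmem]
      exact ⟨⟨by omega, by simp⟩, by omega, fun hx => by omega⟩⟩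
  obtain ⟨d, hd, hdmin⟩ := Finset.exists_min_image (V.filter (fun v => c < v)) id
    ⟨n + 2, by
      simp only [Finset.mem_filter, hVmem] at hc ⊢
      exact ⟨⟨by omega, by simp⟩, by omega⟩⟩
  simp only [Finset.mem_filter, hVmem, id] at hc hcmax hd hdmin
  obtain ⟨⟨hcn, hcV⟩, hcm, hca⟩ := hc
  obtain ⟨⟨hdn, hdV⟩, hcd⟩ := hd
  refine ⟨c, d, hcd, by omega, ?_, ?_, ?_⟩
  · intro x y hx hy
    have hx' : f x < f l := by
      rcases hx with ⟨h1, h2, h3⟩ | ⟨h1, rfl | rfl⟩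
      · by_contra hge
        have := hdmin x ⟨⟨by omega, Or.inr (Or.inr (Or.inl ⟨h3, by omega⟩))⟩, h1⟩
        omega
      · have := hmem x
        have := hnb x
        grind
      · have := hmem x
        have := hnb x
        grind
    have hy' : f l ≤ f y := by
      rcases hy with ⟨h1, h2, h3⟩ | ⟨h1, rfl | rfl⟩
      · by_contra hge
        have := hdmin y ⟨⟨by omega, Or.inr (Or.inr (Or.inr ⟨h3, by omega⟩))⟩, h1⟩
        omega
      · have := hmem y
        have := hnb y
        grind
      · have := hmem y
        have := hnb y
        grind
    omega
  · refine ⟨by omega, ?_⟩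
    have hcl : l ∈ D → l ≤ c := by
      intro hlD
      exact hcmax l ⟨⟨by omega, Or.inr (Or.inr (Or.inl ⟨hlD, le_rfl⟩))⟩, hlm,
        fun hx => hnb l hlD hx.2⟩
    have := hmem c
    have := hnb c
    have := hnb l
    have hmb : m ≤ b := by rcases hm with hm | hm <;> omega
    rcases hl with hl | hl <;> grind
  · refine ⟨by omega, ?_⟩
    have hdm : m ∈ U → d ≤ m := by
      intro hmU
      exact hdmin m ⟨⟨by omega, Or.inr (Or.inr (Or.inr ⟨hmU, hf⟩))⟩, hcm⟩
    have hdlt : d < m → a < d ∧ d ∈ U := by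
      intro hlt
      by_contra hno
      have := hcmax d ⟨⟨hdn, hdV⟩, hlt, hno⟩
      omega
    have := hmem d
    have := hnb d
    have := hnb m
    have hmb : m ≤ b := by rcases hm with hm | hm <;> omega
    have hal : a ≤ l := by rcases hl with hl | hl <;> omega
    rcases hm with hm | hm <;> grind

theorem isInternalDiag_of_crossing {n : ℕ} {D U : Finset ℕ} (h : Split n D U) {a b c d : ℕ}
    (hab : a < b) (hb : b ≤ n + 2) (hcd : c < d) (hd : d ≤ n + 2) (h1 : Below n D U a b c)
    (h2 : Below n U D a b d) : IsInternalDiag n D U (c, d) := by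
  rw [isInternalDiag_iff h]
  rw [← strictBetween_iff_below h hab hb] at h1
  rw [← strictBetween_iff_above h hab hb] at h2
  obtain ⟨h3, h4⟩ := strictBetween_symm_of_crossing h (by omega) hb h1 h2
  exact ⟨⟨hcd, hd⟩, ⟨b, (strictBetween_iff_below h hcd hd b).1 h3⟩,
    ⟨a, (strictBetween_iff_above h hcd hd a).1 h4⟩⟩

theorem isTriangulation_orderTriangulation {n : ℕ} {D U : Finset ℕ} (h : Split n D U)
    {f : ℕ → ℤ} (hf : ∀ x y, f x = f y → x = y) :
    IsTriangulation n D U (orderTriangulation n D U f) := by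
  refine ⟨fun δ hδ => (mem_orderTriangulation.1 hδ).1, ?_, ?_⟩
  · rintro ⟨a, b⟩ hδ ⟨c, d⟩ hδ' hc
    obtain ⟨⟨⟨hab, hb⟩, -⟩, hs⟩ := mem_orderTriangulation.1 hδ
    obtain ⟨⟨⟨hcd, hd⟩, -⟩, hs'⟩ := mem_orderTriangulation.1 hδ'
    simp only at hab hb hcd hd hs hs'
    rcases (cross_iff h hab hb hcd.ne).1 hc with ⟨h1, h2⟩ | ⟨h1, h2⟩
    · exact hs.not_crossing h hab hcd hs' h1 h2
    · exact hs.swap.not_crossing h.symm hab hcd hs'.swap h2 h1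
  · rintro ⟨a, b⟩ hint hnot
    obtain ⟨hab, hb⟩ := ((isInternalDiag_iff h a b).1 hint).1
    have hns : ¬ Separates D U f a b := fun hs => hnot (mem_orderTriangulation.2 ⟨hint, hs⟩)
    simp only [Separates, not_forall, not_lt] at hns
    obtain ⟨l, m, hl, hm, hle⟩ := hns
    have hlm : l ≠ m := by
      rintro rfl
      have := h.not_both l
      rcases hl with hl | hl <;> rcases hm with hm | hm <;> grind
    have hlt : f m < f l := lt_of_le_of_ne hle fun he => hlm (hf _ _ he).symm
    rcases lt_or_gt_of_ne hlm with hlm | hlm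
    · obtain ⟨c, d, hcd, hd, hs, h1, h2⟩ :=
        exists_separates_crossing h hab hb hl hm hlm hlt
      exact ⟨(c, d), mem_orderTriangulation.2
        ⟨isInternalDiag_of_crossing h hab hb hcd hd h1 h2, hs⟩,
        (cross_iff h hab hb hcd.ne).2 (Or.inl ⟨h1, h2⟩)⟩
    · obtain ⟨c, d, hcd, hd, hs, h1, h2⟩ :=
        exists_separates_crossing (f := fun j => - f j) h.symm hab hb hm hl hlm (neg_lt_neg hlt)
      have hs' : Separates D U f c d := by simpa using hs.swap
      exact ⟨(c, d), mem_orderTriangulation.2 ⟨(isInternalDiag_swap h _).1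
        (isInternalDiag_of_crossing h.symm hab hb hcd hd h1 h2), hs'⟩,
        (cross_iff h hab hb hcd.ne).2 (Or.inr ⟨h2, h1⟩)⟩

theorem lower_midOf {n : ℕ} {D U : Finset ℕ} {a b c : ℕ} (hab : a < b)
    (hc : Below n D U a b c) : Lower D U a b (midOf a b c) := by
  obtain ⟨-, hc | hc | hc⟩ := hc
  · rw [midOf, if_neg (by omega), if_pos hc.2.1]
    exact Or.inl hc
  · rw [midOf, if_pos hc.1]
    exact Or.inr ⟨hc.2, Or.inl rfl⟩
  · rw [midOf, if_neg (by omega), if_neg (by omega)]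
    exact Or.inr ⟨hc.2, Or.inr rfl⟩

theorem increasesOnSpine_orderTriangulation {n : ℕ} {D U : Finset ℕ} (h : Split n D U)
    {f : ℕ → ℤ} (hf : ∀ x y, f x = f y → x = y) :
    IncreasesOnSpine n D U (orderTriangulation n D U f) f := by
  intro a b c c' hc hc' ht _
  have he := ht.joined.1
  have hab := (edgeOf_isDiag (isTriangulation_orderTriangulation h hf) he).1
  exact (mem_orderTriangulation.1 (he.mem_of_below_of_above h hc hc')).2 _ _
    (lower_midOf hab hc) (lower_midOf hab hc')

theorem IncreasesOnSpine.le_midOf {n : ℕ} {D U : Finset ℕ} {T : Finset (ℕ × ℕ)} {f : ℕ → ℤ}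
    (h : Split n D U) (hT : IsTriangulation n D U T) (hf : IncreasesOnSpine n D U T f)
    {a b c l : ℕ} (hc : Below n D U a b c) (ht : TriWith n D U T (a, b) c)
    (hl : Lower D U a b l) : f l ≤ f (midOf a b c) := by
  by_cases hne : l = midOf a b c
  · rw [hne]
  have hda := h.not_both a
  have hdb := h.not_both b
  obtain ⟨-, hc⟩ := hc
  apply le_of_lt
  rcases triWith_iff.1 ht with ⟨h1, h2⟩ | ⟨h1, h1', h2⟩ | ⟨h1, h2⟩
  · have hmid : midOf a b c = a := by rw [midOf, if_pos h1]
    rw [hmid] at hne ⊢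
    refine h2.lower_lt h hT hf ?_ hne
    rcases hl with hl | ⟨hl, rfl | rfl⟩
    · exact Or.inl ⟨by omega, hl.2⟩
    · exact absurd rfl hne
    · exact Or.inr ⟨hl, Or.inr rfl⟩
  · have hmid : midOf a b c = c := by rw [midOf, if_neg (by omega), if_pos h1']
    rw [hmid] at hne ⊢
    exact h2.lower_lt h hT hf hl hne
  · have hab := h2.1
    have hmid : midOf a b c = b := by rw [midOf, if_neg (by omega), if_neg (by omega)]
    rw [hmid] at hne ⊢
    refine h2.lower_lt h hT hf ?_ hne
    rcases hl with hl | ⟨hl, rfl | rfl⟩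
    · exact Or.inl ⟨hl.1, by omega, hl.2.2⟩
    · exact Or.inr ⟨hl, Or.inl rfl⟩
    · exact absurd rfl hne

theorem IncreasesOnSpine.midOf_le {n : ℕ} {D U : Finset ℕ} {T : Finset (ℕ × ℕ)} {f : ℕ → ℤ}
    (h : Split n D U) (hT : IsTriangulation n D U T) (hf : IncreasesOnSpine n D U T f)
    {a b c l : ℕ} (hc : Below n U D a b c) (ht : TriWith n D U T (a, b) c)
    (hl : Lower U D a b l) : f (midOf a b c) ≤ f l :=
  neg_le_neg_iff.1 ((hf.swap h).le_midOf h.symm (isTriangulation_swap h hT) hc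
    ((triWith_swap h T _ c).2 ht) hl)

theorem eq_orderTriangulation {n : ℕ} {D U : Finset ℕ} {T : Finset (ℕ × ℕ)} {f : ℕ → ℤ}
    (h : Split n D U) (hT : IsTriangulation n D U T) (hinj : ∀ x y, f x = f y → x = y)
    (hf : IncreasesOnSpine n D U T f) : T = orderTriangulation n D U f := by
  have hsub : T ⊆ orderTriangulation n D U f := by
    rintro ⟨a, b⟩ hδ
    have hint := hT.1 _ hδ
    obtain ⟨-, hv, hv'⟩ := (isInternalDiag_iff h a b).1 hint
    obtain ⟨c, hc, ht⟩ := exists_triWith_below h hT (Or.inl hδ) hv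
    obtain ⟨c', hc', ht'⟩ := exists_triWith_above h hT (Or.inl hδ) hv'
    refine mem_orderTriangulation.2 ⟨hint, fun l m hl hm => ?_⟩
    exact (hf.le_midOf h hT hc ht hl).trans_lt
      ((hf a b c c' hc hc' ht ht').trans_le (hf.midOf_le h hT hc' ht' hm))
  refine hsub.antisymm fun δ hδ => ?_
  by_contra hnot
  have hT' := isTriangulation_orderTriangulation h hinj
  obtain ⟨δ', hδ', hc⟩ := hT.2.2 δ (hT'.1 _ hδ) hnot
  exact hT'.2.1 _ hδ _ (hsub hδ') hc

theorem exists_triangle_of_mem_down {n : ℕ} {D U : Finset ℕ} {T : Finset (ℕ × ℕ)}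
    (h : Split n D U) (hT : IsTriangulation n D U T) {j : ℕ} (hj : j ∈ D) :
    ∃ i k, IsTriangleOf n D U T i j k := by
  have hj1 := (h.mem_or j).1 (Or.inl hj)
  have hjU := h.not_both j hj
  obtain ⟨p, hp, hpmax⟩ := Finset.exists_max_image
    ((Finset.range j).filter (fun v => v = 0 ∨ v ∈ D)) id
    ⟨0, by simp only [Finset.mem_filter, Finset.mem_range]; exact ⟨by omega, by simp⟩⟩
  simp only [Finset.mem_filter, Finset.mem_range, id] at hp hpmax
  have hpj : EdgeOf n D U T p j := by
    refine Or.inr ((isBoundaryEdge_iff h p j).2 ⟨⟨hp.1, by omega⟩, Or.inl fun v hv => ?_⟩)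
    rw [strictBetween_iff_below h hp.1 (by omega)] at hv
    have hp0 := h.mem_or p
    have hpd := h.not_both p
    obtain ⟨-, hv | hv | hv⟩ := hv
    · have := hpmax v ⟨hv.2.1, Or.inr hv.2.2⟩
      omega
    · have := hp0.1 (Or.inr hv.2)
      rcases hp.2 with hp | hp
      · omega
      · exact hpd hp hv.2
    · exact hjU hv.2
  obtain ⟨i, hi, hmin⟩ := Finset.exists_min_image
    ((Finset.range j).filter (fun v => EdgeOf n D U T v j)) (fun v => relpos n D U j v)
    ⟨p, Finset.mem_filter.2 ⟨Finset.mem_range.2 hp.1, hpj⟩⟩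
  simp only [Finset.mem_filter, Finset.mem_range] at hi hmin
  obtain ⟨c, hc, ht⟩ := exists_triWith_above h hT hi.2
    ⟨n + 2, le_rfl, Or.inr (Or.inr ⟨by omega, hj⟩)⟩
  obtain ⟨-, -, hcj⟩ := ht.joined
  have hcne := (hc.ne hi.1).2
  by_cases hlt : c < j
  · have h1 := hmin c ⟨hlt, hcj.edgeOf hT hlt⟩
    have h2 := ((strictBetween_iff_above h hi.1 (by omega) c).2 hc).2.2
    omega
  · rcases triWith_iff.1 ht with h1 | h1 | h1
    · omega
    · omega
    · exact ⟨i, c, h1.2⟩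

theorem exists_triangle {n : ℕ} {D U : Finset ℕ} {T : Finset (ℕ × ℕ)}
    (h : Split n D U) (hT : IsTriangulation n D U T) {j : ℕ} (hj : 1 ≤ j ∧ j ≤ n + 1) :
    ∃ i k, IsTriangleOf n D U T i j k := by
  rcases (h.mem_or j).2 hj with hj | hj
  · exact exists_triangle_of_mem_down h hT hj
  · obtain ⟨i, k, hik⟩ := exists_triangle_of_mem_down h.symm (isTriangulation_swap h hT) hj
    exact ⟨i, k, (isTriangleOf_swap h T i j k).1 hik⟩

/-- Explicit description of membership in `Bel {a,b}` for labels. -/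
def InBel (D U : Finset ℕ) (a b l : ℕ) : Prop :=
  (a < l ∧ l < b ∧ l ∈ D) ∨ (l ≤ a ∧ a ∈ U) ∨ (b ≤ l ∧ b ∈ U)

theorem Lower.inBel {D U : Finset ℕ} {a b l : ℕ} (hl : Lower D U a b l) : InBel D U a b l := by
  rcases hl with hl | ⟨hl, rfl | rfl⟩
  · exact Or.inl hl
  · exact Or.inr (Or.inl ⟨le_rfl, hl⟩)
  · exact Or.inr (Or.inr ⟨le_rfl, hl⟩)

theorem inBel_or_swap {n : ℕ} {D U : Finset ℕ} (h : Split n D U) {a b l : ℕ} (hab : a < b)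
    (hb : b ≤ n + 2) (hl : 1 ≤ l ∧ l ≤ n + 1) : InBel D U a b l ∨ InBel U D a b l := by
  have h1 := h.mem_or a
  have h2 := h.mem_or b
  have h3 := h.mem_or l
  rcases le_or_gt l a with hla | hla
  · rcases h1.2 (by omega) with h1 | h1
    · exact Or.inr (Or.inr (Or.inl ⟨hla, h1⟩))
    · exact Or.inl (Or.inr (Or.inl ⟨hla, h1⟩))
  rcases le_or_gt b l with hlb | hlb
  · rcases h2.2 (by omega) with h2 | h2
    · exact Or.inr (Or.inr (Or.inr ⟨hlb, h2⟩))
    · exact Or.inl (Or.inr (Or.inr ⟨hlb, h2⟩))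
  · rcases h3.2 hl with h3 | h3
    · exact Or.inl (Or.inl ⟨hla, hlb, h3⟩)
    · exact Or.inr (Or.inl ⟨hla, hlb, h3⟩)

theorem not_inBel_of_swap {n : ℕ} {D U : Finset ℕ} (h : Split n D U) {a b l : ℕ} (hab : a < b)
    (h1 : InBel D U a b l) (h2 : InBel U D a b l) : False := by
  have ha := h.not_both a
  have hb := h.not_both b
  have hl := h.not_both l
  rcases h1 with h1 | h1 | h1 <;> rcases h2 with h2 | h2 | h2 <;> first | omega | tauto

/-- `v` is an endpoint of `{a,b}` or lies strictly below it. -/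
def WeaklyBelow (n : ℕ) (D U : Finset ℕ) (a b v : ℕ) : Prop :=
  v = a ∨ v = b ∨ Below n D U a b v

theorem EdgeOf.weaklyBelow {n : ℕ} {D U : Finset ℕ} {T : Finset (ℕ × ℕ)} (h : Split n D U)
    (hT : IsTriangulation n D U T) {a b z w : ℕ} (he : EdgeOf n D U T a b)
    (hzw : Joined n D U T z w) (hz : Below n D U a b z) : WeaklyBelow n D U a b w := by
  obtain ⟨hab, hb⟩ := edgeOf_isDiag hT he
  by_cases ha : w = a
  · exact Or.inl ha
  by_cases hb' : w = b
  · exact Or.inr (Or.inl hb')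
  rcases below_or_above h hab hb (hzw.le hT).2.1 ha hb' with hw | hw
  · exact Or.inr (Or.inr hw)
  · exact (he.not_crossing h hT hzw hz hw).elim

theorem IsTriangleOf.weaklyBelow {n : ℕ} {D U : Finset ℕ} {T : Finset (ℕ × ℕ)}
    (h : Split n D U) (hT : IsTriangulation n D U T) {a b i j k : ℕ} (he : EdgeOf n D U T a b)
    (ht : IsTriangleOf n D U T i j k) (hj : InBel D U a b j) :
    WeaklyBelow n D U a b i ∧ WeaklyBelow n D U a b j ∧ WeaklyBelow n D U a b k := by
  obtain ⟨hij, hjk, hk, e1, e2, e3⟩ := ht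
  have of_mid : Below n D U a b j →
      WeaklyBelow n D U a b i ∧ WeaklyBelow n D U a b j ∧ WeaklyBelow n D U a b k :=
    fun hb => ⟨he.weaklyBelow h hT (Or.inr e1) hb, Or.inr (Or.inr hb),
      he.weaklyBelow h hT (Or.inl e2) hb⟩
  rcases hj with hj | ⟨hj, ha⟩ | ⟨hj, hb⟩
  · exact of_mid ⟨by omega, Or.inl hj⟩
  · rcases hj.lt_or_eq with hlt | rfl
    · exact of_mid ⟨by omega, Or.inr (Or.inl ⟨hlt, ha⟩)⟩
    · have hi : Below n D U j b i := ⟨by omega, Or.inr (Or.inl ⟨hij, ha⟩)⟩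
      exact ⟨Or.inr (Or.inr hi), Or.inl rfl, he.weaklyBelow h hT (Or.inl e3) hi⟩
  · rcases hj.lt_or_eq with hlt | rfl
    · exact of_mid ⟨by omega, Or.inr (Or.inr ⟨hlt, hb⟩)⟩
    · have hi : Below n D U a b k := ⟨by omega, Or.inr (Or.inr ⟨hjk, hb⟩)⟩
      exact ⟨he.weaklyBelow h hT (Or.inr e3) hi, Or.inr (Or.inl rfl), Or.inr (Or.inr hi)⟩

theorem TriWith.weaklyBelow {n : ℕ} {D U : Finset ℕ} {T : Finset (ℕ × ℕ)}
    (h : Split n D U) (hT : IsTriangulation n D U T) {a b c x y : ℕ}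
    (he : EdgeOf n D U T x y) (ht : TriWith n D U T (a, b) c)
    (hj : InBel D U x y (midOf a b c)) :
    WeaklyBelow n D U x y a ∧ WeaklyBelow n D U x y b ∧ WeaklyBelow n D U x y c := by
  rcases triWith_iff.1 ht with ⟨h1, h2⟩ | ⟨h1, h1', h2⟩ | ⟨h1, h2⟩
  · rw [midOf, if_pos h1] at hj
    obtain ⟨g1, g2, g3⟩ := h2.weaklyBelow h hT he hj
    exact ⟨g2, g3, g1⟩
  · rw [midOf, if_neg (by omega), if_pos h1'] at hj
    obtain ⟨g1, g2, g3⟩ := h2.weaklyBelow h hT he hj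
    exact ⟨g1, g3, g2⟩
  · have hab := h2.1
    rw [midOf, if_neg (by omega), if_neg (by omega)] at hj
    obtain ⟨g1, g2, g3⟩ := h2.weaklyBelow h hT he hj
    exact ⟨g1, g2, g3⟩

theorem WeaklyBelow.eq_or_eq {n : ℕ} {D U : Finset ℕ} (h : Split n D U) {a b v : ℕ}
    (hab : a < b) (h1 : WeaklyBelow n D U a b v) (h2 : WeaklyBelow n U D a b v) :
    v = a ∨ v = b := by
  rcases h1 with h1 | h1 | h1
  · exact Or.inl h1
  · exact Or.inr h1
  rcases h2 with h2 | h2 | h2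
  · exact Or.inl h2
  · exact Or.inr h2
  · exact (not_below_and_above h hab h1 h2).elim

theorem TriWith.midOf_mem {n : ℕ} {D U : Finset ℕ} {T : Finset (ℕ × ℕ)} {a b c : ℕ}
    (ht : TriWith n D U T (a, b) c) : 1 ≤ midOf a b c ∧ midOf a b c ≤ n + 1 := by
  rcases triWith_iff.1 ht with ⟨h1, g1, g2, g3, -⟩ | ⟨h1, h1', g1, g2, g3, -⟩ |
    ⟨h1, g1, g2, g3, -⟩
  · rw [midOf, if_pos h1]
    omega
  · rw [midOf, if_neg (by omega), if_pos h1']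
    omega
  · rw [midOf, if_neg (by omega), if_neg (by omega)]
    omega

/-- The number of diagonals of `T` above which the label `j` lies. -/
def height (D U : Finset ℕ) (T : Finset (ℕ × ℕ)) (j : ℕ) : ℕ :=
  (T.filter (fun δ => InBel U D δ.1 δ.2 j)).card

theorem height_lt {n : ℕ} {D U : Finset ℕ} {T : Finset (ℕ × ℕ)} (h : Split n D U)
    (hT : IsTriangulation n D U T) {a b c c' : ℕ} (hc : Below n D U a b c)
    (hc' : Below n U D a b c') (ht : TriWith n D U T (a, b) c)
    (ht' : TriWith n D U T (a, b) c') :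
    height D U T (midOf a b c) < height D U T (midOf a b c') := by
  have he := ht.joined.1
  obtain ⟨hab, hb⟩ := edgeOf_isDiag hT he
  have hs := (lower_midOf hab hc).inBel
  have hs' := (lower_midOf hab hc').inBel
  have hmem := he.mem_of_below_of_above h hc hc'
  apply Finset.card_lt_card
  refine Finset.ssubset_iff_of_subset ?_ |>.2 ⟨(a, b), Finset.mem_filter.2 ⟨hmem, hs'⟩, ?_⟩
  · rintro ⟨x, y⟩ hδ
    obtain ⟨hδ, hx⟩ := Finset.mem_filter.1 hδ
    refine Finset.mem_filter.2 ⟨hδ, ?_⟩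
    obtain ⟨hxy, hy⟩ := (hT.1 _ hδ).1
    simp only at hxy hy hx ⊢
    rcases inBel_or_swap h hxy hy ht'.midOf_mem with hx' | hx'
    · exfalso
      obtain ⟨g1, g2, g3⟩ := TriWith.weaklyBelow h.symm (isTriangulation_swap h hT)
        ((edgeOf_swap h T x y).2 (Or.inl hδ)) ((triWith_swap h T _ c).2 ht) hx
      obtain ⟨g1', g2', -⟩ := TriWith.weaklyBelow h hT (Or.inl hδ) ht' hx'
      have hax := g1'.eq_or_eq h hxy g1
      have hbx := g2'.eq_or_eq h hxy g2
      obtain ⟨rfl, rfl⟩ : a = x ∧ b = y := by omega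
      have hne := hc.ne hab
      have := WeaklyBelow.eq_or_eq h hab (Or.inr (Or.inr hc)) g3
      omega
    · exact hx'
  · intro hmem'
    exact not_inBel_of_swap h hab hs (Finset.mem_filter.1 hmem').2

theorem exists_increasesOnSpine {n : ℕ} {D U : Finset ℕ} {T : Finset (ℕ × ℕ)}
    (h : Split n D U) (hT : IsTriangulation n D U T) :
    ∃ f : ℕ → ℤ, IncreasesOnSpine n D U T f ∧
      ∀ x ≤ n + 1, ∀ y ≤ n + 1, f x = f y → x = y := by
  refine ⟨fun j => ((height D U T j * (n + 3) + j : ℕ) : ℤ), ?_, ?_⟩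
  · intro a b c c' hc hc' ht ht'
    have h1 := height_lt h hT hc hc' ht ht'
    have h2 := ht.midOf_mem
    simp only [Nat.cast_lt]
    calc height D U T (midOf a b c) * (n + 3) + midOf a b c
        < (height D U T (midOf a b c) + 1) * (n + 3) := by rw [add_mul]; omega
      _ ≤ height D U T (midOf a b c') * (n + 3) := Nat.mul_le_mul_right _ h1
      _ ≤ _ := Nat.le_add_right _ _
  · intro x hx y hy hxy
    simp only [Nat.cast_inj] at hxy
    have := congrArg (· % (n + 3)) hxy
    simp only [Nat.mul_add_mod_self_right] at this
    rwa [Nat.mod_eq_of_lt (by omega), Nat.mod_eq_of_lt (by omega)] at this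

theorem mem_bel_iff {n : ℕ} {D U : Finset ℕ} (h : Split n D U) {a b : ℕ} (hab : a < b)
    (hb : b ≤ n + 2) (l : ℕ) :
    l ∈ Bel n D U (a, b) ↔ (1 ≤ l ∧ l ≤ n + 1) ∧ InBel D U a b l := by
  rw [Bel, Finset.mem_filter, Finset.mem_Icc, strictBetween_iff_below h hab hb, Below, InBel]
  grind

theorem bel_le {n : ℕ} (D U : Finset ℕ) (δ : ℕ × ℕ) : bel n D U δ ≤ n + 1 := by
  have := Finset.card_le_card (Finset.filter_subset
    (fun j => StrictBetween n D U δ.1 δ.2 j ∨ (j ∈ U ∧ (j = δ.1 ∨ j = δ.2)))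
    (Finset.Icc 1 (n + 1)))
  rw [Nat.card_Icc] at this
  exact this

theorem bel_of_mem_down {n : ℕ} {D U : Finset ℕ} (h : Split n D U) {i j k : ℕ} (hij : i < j)
    (hjk : j < k) (hk : k ≤ n + 2) (hj : j ∈ D) :
    bel n D U (i, k) = bel n D U (i, j) + bel n D U (j, k) + 1 := by
  have hjU := h.not_both j hj
  have hi := h.mem_or i
  have hm := h.mem_or k
  have hji := (h.mem_or j).1 (Or.inl hj)
  have hd : Disjoint (Bel n D U (i, j)) (Bel n D U (j, k)) := by
    rw [Finset.disjoint_left]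
    intro l
    rw [mem_bel_iff h hij (by omega), mem_bel_iff h hjk hk, InBel, InBel]
    grind
  have hn : j ∉ Bel n D U (i, j) ∪ Bel n D U (j, k) := by
    rw [Finset.mem_union, mem_bel_iff h hij (by omega), mem_bel_iff h hjk hk, InBel, InBel]
    grind
  rw [bel, bel, bel, ← Finset.card_union_of_disjoint hd, ← Finset.card_insert_of_notMem hn]
  congr 1
  ext l
  have hl := h.mem_or l
  rw [Finset.mem_insert, Finset.mem_union, mem_bel_iff h hij (by omega), mem_bel_iff h hjk hk,
    mem_bel_iff h (hij.trans hjk) hk, InBel, InBel, InBel]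
  grind

theorem bel_of_mem_up {n : ℕ} {D U : Finset ℕ} (h : Split n D U) {i j k : ℕ} (hij : i < j)
    (hjk : j < k) (hk : k ≤ n + 2) (hj : j ∈ U) :
    bel n D U (i, j) + bel n D U (j, k) = bel n D U (i, k) + (n + 2) := by
  have hjD : j ∉ D := fun hD => h.not_both j hD hj
  have hi := h.mem_or i
  have hm := h.mem_or k
  have hji := (h.mem_or j).1 (Or.inr hj)
  have hu : Bel n D U (i, j) ∪ Bel n D U (j, k) = Finset.Icc 1 (n + 1) := by
    ext l
    rw [Finset.mem_union, mem_bel_iff h hij (by omega), mem_bel_iff h hjk hk, InBel, InBel,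
      Finset.mem_Icc]
    grind
  have hn : j ∉ Bel n D U (i, k) := by
    rw [mem_bel_iff h (hij.trans hjk) hk, InBel]
    grind
  have hi' : Bel n D U (i, j) ∩ Bel n D U (j, k) = insert j (Bel n D U (i, k)) := by
    ext l
    have hl := h.mem_or l
    rw [Finset.mem_insert, Finset.mem_inter, mem_bel_iff h hij (by omega), mem_bel_iff h hjk hk,
      mem_bel_iff h (hij.trans hjk) hk, InBel, InBel, InBel]
    grind
  have hc := Finset.card_union_add_card_inter (Bel n D U (i, j)) (Bel n D U (j, k))
  rw [hu, hi', Finset.card_insert_of_notMem hn, Nat.card_Icc] at hc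
  rw [bel, bel, bel]
  omega

/-- `i` and `k` are the neighbours of `j` among the elements of `V` different from `j`. -/
def Surrounds (V : Finset ℕ) (i j k : ℕ) : Prop :=
  i ∈ V ∧ k ∈ V ∧ i < j ∧ j < k ∧ ∀ v ∈ V, v ≤ i ∨ v = j ∨ k ≤ v

theorem Surrounds.unique {V : Finset ℕ} {i j k i' k' : ℕ} (hs : Surrounds V i j k)
    (hs' : Surrounds V i' j k') : i = i' ∧ k = k' := by
  obtain ⟨h1, h2, h3, h4, h5⟩ := hs
  obtain ⟨h1', h2', h3', h4', h5'⟩ := hs'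
  have := h5 i' h1'
  have := h5 k' h2'
  have := h5' i h1
  have := h5' k h2
  omega

theorem exists_surrounds {V : Finset ℕ} {j : ℕ} (hl : ∃ v ∈ V, v < j) (hu : ∃ v ∈ V, j < v) :
    ∃ i k, Surrounds V i j k := by
  obtain ⟨a, ha, haj⟩ := hl
  obtain ⟨b, hb, hjb⟩ := hu
  obtain ⟨i, hi, himax⟩ := Finset.exists_max_image (V.filter (fun v => v < j)) id
    ⟨a, Finset.mem_filter.2 ⟨ha, haj⟩⟩
  obtain ⟨k, hk, hkmin⟩ := Finset.exists_min_image (V.filter (fun v => j < v)) id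
    ⟨b, Finset.mem_filter.2 ⟨hb, hjb⟩⟩
  rw [Finset.mem_filter] at hi hk
  refine ⟨i, k, hi.1, hk.1, hi.2, hk.2, fun v hv => ?_⟩
  rcases lt_trichotomy v j with hvj | hvj | hvj
  · exact Or.inl (himax v (Finset.mem_filter.2 ⟨hv, hvj⟩))
  · exact Or.inr (Or.inl hvj)
  · exact Or.inr (Or.inr (hkmin v (Finset.mem_filter.2 ⟨hv, hvj⟩)))

/-- The pairs of consecutive elements of `V`. -/
def consec (V : Finset ℕ) : Finset (ℕ × ℕ) :=
  (V ×ˢ V).filter (fun p => p.1 < p.2 ∧ ∀ v ∈ V, v ≤ p.1 ∨ p.2 ≤ v)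

theorem sum_consec_insert {V : Finset ℕ} {i j k : ℕ} (hj : j ∉ V) (hs : Surrounds V i j k)
    (w : ℕ × ℕ → ℝ) :
    ∑ p ∈ consec (insert j V), w p = ∑ p ∈ consec V, w p - w (i, k) + w (i, j) + w (j, k) := by
  obtain ⟨hi, hk, hij, hjk, hV⟩ := hs
  have hV' : ∀ v ∈ V, v ≤ i ∨ k ≤ v := by
    intro v hv
    rcases hV v hv with h1 | rfl | h1
    · exact Or.inl h1
    · exact absurd hv hj
    · exact Or.inr h1
  have hik : (i, k) ∈ consec V := by
    simp only [consec, Finset.mem_filter, Finset.mem_product]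
    exact ⟨⟨hi, hk⟩, hij.trans hjk, hV'⟩
  have he : consec (insert j V) = insert (i, j) (insert (j, k) ((consec V).erase (i, k))) := by
    ext ⟨a, b⟩
    simp only [consec, Finset.mem_filter, Finset.mem_product, Finset.mem_insert,
      Finset.mem_erase, Prod.mk.injEq, ne_eq]
    constructor
    · rintro ⟨⟨ha, hb⟩, hab, hall⟩
      have hja := hall j (Or.inl rfl)
      have hab' := fun v hv => hall v (Or.inr hv)
      rcases ha with rfl | ha
      · rcases hb with rfl | hb
        · omega
        · have := hab' k hk
          have := hV' b hb
          omega
      · rcases hb with rfl | hb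
        · have := hab' i hi
          have := hV' a ha
          omega
        · refine Or.inr (Or.inr ⟨?_, ⟨ha, hb⟩, hab, hab'⟩)
          omega
    · rintro (⟨rfl, rfl⟩ | ⟨rfl, rfl⟩ | ⟨hne, ⟨ha, hb⟩, hab, hab'⟩)
      · refine ⟨⟨Or.inr hi, Or.inl rfl⟩, hij, fun v hv => ?_⟩
        rcases hv with rfl | hv
        · omega
        · have := hV' v hv
          omega
      · refine ⟨⟨Or.inl rfl, Or.inr hk⟩, hjk, fun v hv => ?_⟩
        rcases hv with rfl | hv
        · omega
        · have := hV' v hv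
          omega
      · refine ⟨⟨Or.inr ha, Or.inr hb⟩, hab, fun v hv => ?_⟩
        rcases hv with rfl | hv
        swap
        · exact hab' v hv
        have := hab' i hi
        have := hab' k hk
        have := hV' a ha
        have := hV' b hb
        omega
  have hn1 : (j, k) ∉ (consec V).erase (i, k) := by
    simp only [consec, Finset.mem_erase, Finset.mem_filter, Finset.mem_product]
    exact fun hc => hj hc.2.1.1
  have hn2 : (i, j) ∉ insert (j, k) ((consec V).erase (i, k)) := by
    simp only [consec, Finset.mem_insert, Finset.mem_erase, Finset.mem_filter,
      Finset.mem_product, Prod.mk.injEq]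
    rintro (hc | hc)
    · omega
    · exact hj hc.2.1.2
  rw [he, Finset.sum_insert hn2, Finset.sum_insert hn1, ← Finset.add_sum_erase _ _ hik]
  ring

/-- The vertices of the monotone path from `0` to `n+2` having the labels in `B` below it or
as up vertices on it. -/
def pathVerts (n : ℕ) (D U B : Finset ℕ) : Finset ℕ :=
  (Finset.range (n + 3)).filter
    (fun v => v = 0 ∨ v = n + 2 ∨ (v ∈ D ∧ v ∉ B) ∨ (v ∈ U ∧ v ∈ B))

theorem mem_pathVerts {n : ℕ} {D U : Finset ℕ} (h : Split n D U) {B : Finset ℕ} {v : ℕ} :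
    v ∈ pathVerts n D U B ↔ v = 0 ∨ v = n + 2 ∨ (v ∈ D ∧ v ∉ B) ∨ (v ∈ U ∧ v ∈ B) := by
  have := h.mem_or v
  rw [pathVerts, Finset.mem_filter, Finset.mem_range]
  grind

theorem exists_surrounds_pathVerts {n : ℕ} {D U : Finset ℕ} (h : Split n D U) (B : Finset ℕ)
    {j : ℕ} (hj : 1 ≤ j ∧ j ≤ n + 1) : ∃ i k, Surrounds (pathVerts n D U B) i j k := by
  apply exists_surrounds
  · exact ⟨0, (mem_pathVerts h).2 (Or.inl rfl), by omega⟩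
  · exact ⟨n + 2, (mem_pathVerts h).2 (Or.inr (Or.inl rfl)), by omega⟩

theorem Surrounds.le_last {n : ℕ} {D U B : Finset ℕ} {i j k : ℕ}
    (hs : Surrounds (pathVerts n D U B) i j k) : k ≤ n + 2 := by
  have := (Finset.mem_filter.1 hs.2.1).1
  rw [Finset.mem_range] at this
  omega

/-- The labels preceding `j` in the order given by `f`. -/
def before (n : ℕ) (f : ℕ → ℤ) (j : ℕ) : Finset ℕ :=
  (Finset.Icc 1 (n + 1)).filter (fun l => f l < f j)

theorem IsTriangleOf.surrounds {n : ℕ} {D U : Finset ℕ} {T : Finset (ℕ × ℕ)} {f : ℕ → ℤ}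
    (h : Split n D U) (hT : IsTriangulation n D U T) (hf : IncreasesOnSpine n D U T f)
    {i j k : ℕ} (htri : IsTriangleOf n D U T i j k) :
    Surrounds (pathVerts n D U (before n f j)) i j k := by
  have hlow : ∀ l, Lower D U i k l → l ≠ j → f l < f j := fun l => htri.lower_lt h hT hf
  have hupp : ∀ l, Lower U D i k l → l ≠ j → f j < f l := fun l => htri.lt_upper h hT hf
  obtain ⟨hij, hjk, hk, -⟩ := htri
  have hb : ∀ l, l ∈ before n f j ↔ (1 ≤ l ∧ l ≤ n + 1) ∧ f l < f j := by
    intro l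
    rw [before, Finset.mem_filter, Finset.mem_Icc]
  simp only [Lower] at hlow hupp
  refine ⟨?_, ?_, hij, hjk, fun v hv => ?_⟩
  · rw [mem_pathVerts h, hb]
    have := hlow i
    have := hupp i
    have := h.mem_or i
    rcases h.vertex_cases (v := i) (by omega) with hc | hc | hc | hc <;> grind
  · rw [mem_pathVerts h, hb]
    have := hlow k
    have := hupp k
    have := h.mem_or k
    rcases h.vertex_cases (v := k) (by omega) with hc | hc | hc | hc <;> grind
  · rw [mem_pathVerts h, hb] at hv
    have := hlow v
    have := hupp v
    have := h.mem_or v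
    grind

/-- The coordinate contributed by a triangle with middle vertex `j` whose two short sides have
`a` and `c` labels below them. -/
def coordValue (n : ℕ) (D : Finset ℕ) (j a c : ℕ) : ℝ :=
  if j ∈ D then ((a : ℝ) + 1) * ((c : ℝ) + 1)
  else ((n : ℝ) + 2) - (((n : ℝ) + 2) - (a : ℝ)) * (((n : ℝ) + 2) - (c : ℝ))

theorem coordValue_mono {n : ℕ} {D : Finset ℕ} {j a c a' c' : ℕ} (ha : a ≤ a') (hc : c ≤ c')
    (ha' : a' ≤ n + 1) (hc' : c' ≤ n + 1) : coordValue n D j a c ≤ coordValue n D j a' c' := by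
  have h1 : (a : ℝ) ≤ a' := by exact_mod_cast ha
  have h2 : (c : ℝ) ≤ c' := by exact_mod_cast hc
  have h3 : (a' : ℝ) ≤ n + 1 := by exact_mod_cast ha'
  have h4 : (c' : ℝ) ≤ n + 1 := by exact_mod_cast hc'
  rw [coordValue, coordValue]
  split_ifs
  · gcongr
  · gcongr <;> linarith

theorem xcoord_eq {n : ℕ} {D U : Finset ℕ} {T : Finset (ℕ × ℕ)} {f : ℕ → ℤ}
    (h : Split n D U) (hT : IsTriangulation n D U T) (hf : IncreasesOnSpine n D U T f)
    {j i k : ℕ} (hj : 1 ≤ j ∧ j ≤ n + 1)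
    (hs : Surrounds (pathVerts n D U (before n f j)) i j k) :
    xcoord n D U T j = coordValue n D j (bel n D U (i, j)) (bel n D U (j, k)) := by
  have hex : ∃ p : ℕ × ℕ, IsTriangleOf n D U T p.1 j p.2 := by
    obtain ⟨a, c, hac⟩ := exists_triangle h hT hj
    exact ⟨(a, c), hac⟩
  obtain ⟨h1, h2⟩ := hs.unique (hex.choose_spec.surrounds h hT hf)
  rw [xcoord, dif_pos hex, coordValue, ← h1, ← h2]

theorem Bel_subset_left {n : ℕ} {D U B B' : Finset ℕ} (h : Split n D U) (hB : B ⊆ B')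
    {i j k i' k' : ℕ} (hs : Surrounds (pathVerts n D U B) i j k)
    (hs' : Surrounds (pathVerts n D U B') i' j k') :
    Bel n D U (i, j) ⊆ Bel n D U (i', j) := by
  have hk := hs.le_last
  obtain ⟨hi, -, hij, hjk, hV⟩ := hs
  have hk' := hs'.le_last
  obtain ⟨hi', -, hij', hjk', hV'⟩ := hs'
  intro l
  rw [mem_bel_iff h hij (by omega), mem_bel_iff h hij' (by omega), InBel, InBel]
  rintro ⟨hl, hl'⟩
  refine ⟨hl, ?_⟩
  have h1 := hV i'
  have h2 := hV' i
  rw [mem_pathVerts h] at hi hi' h1 h2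
  have := h.not_both i
  have := h.not_both i'
  have := @hB i
  have := @hB i'
  grind

theorem Bel_subset_right {n : ℕ} {D U B B' : Finset ℕ} (h : Split n D U) (hB : B ⊆ B')
    {i j k i' k' : ℕ} (hs : Surrounds (pathVerts n D U B) i j k)
    (hs' : Surrounds (pathVerts n D U B') i' j k') :
    Bel n D U (j, k) ⊆ Bel n D U (j, k') := by
  have hk := hs.le_last
  have hk' := hs'.le_last
  obtain ⟨-, hi, hij, hjk, hV⟩ := hs
  obtain ⟨-, hi', hij', hjk', hV'⟩ := hs'
  intro l
  rw [mem_bel_iff h hjk hk, mem_bel_iff h hjk' hk', InBel, InBel]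
  rintro ⟨hl, hl'⟩
  refine ⟨hl, ?_⟩
  have h1 := hV k'
  have h2 := hV' k
  rw [mem_pathVerts h] at hi hi' h1 h2
  have := h.not_both k
  have := h.not_both k'
  have := @hB k
  have := @hB k'
  grind

/-- A supermodular set function whose marginal values are the coordinates of the points `x(T)`. -/
def potential (n : ℕ) (D U B : Finset ℕ) : ℝ :=
  ∑ p ∈ consec (pathVerts n D U B), (bel n D U p : ℝ) * ((bel n D U p : ℝ) + 1) / 2
    - ((U ∩ B).card : ℝ) * (((n : ℝ) + 2) * ((n : ℝ) + 1) / 2)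

theorem potential_insert {n : ℕ} {D U B : Finset ℕ} (h : Split n D U) {i j k : ℕ}
    (hj : 1 ≤ j ∧ j ≤ n + 1) (hjB : j ∉ B) (hs : Surrounds (pathVerts n D U B) i j k) :
    potential n D U (insert j B) - potential n D U B =
      coordValue n D j (bel n D U (i, j)) (bel n D U (j, k)) := by
  have hk := hs.le_last
  have hij := hs.2.2.1
  have hjk := hs.2.2.2.1
  rcases (h.mem_or j).2 hj with hD | hU
  · have hjU := h.not_both j hD
    have hu : U ∩ insert j B = U ∩ B := Finset.inter_insert_of_notMem hjU
    have hjP : j ∉ pathVerts n D U (insert j B) := by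
      rw [mem_pathVerts h, Finset.mem_insert]
      grind
    have hP : pathVerts n D U B = insert j (pathVerts n D U (insert j B)) := by
      ext v
      rw [Finset.mem_insert, mem_pathVerts h, mem_pathVerts h, Finset.mem_insert]
      grind
    have hs' : Surrounds (pathVerts n D U (insert j B)) i j k := by
      rw [hP] at hs
      obtain ⟨h1, h2, h3, h4, h5⟩ := hs
      rw [Finset.mem_insert] at h1 h2
      exact ⟨by grind, by grind, h3, h4, fun v hv => h5 v (Finset.mem_insert_of_mem hv)⟩
    have hb : (bel n D U (i, k) : ℝ) = bel n D U (i, j) + bel n D U (j, k) + 1 := by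
      exact_mod_cast bel_of_mem_down h hij hjk hk hD
    rw [potential, potential, hu, hP, sum_consec_insert hjP hs', coordValue, if_pos hD, hb]
    ring
  · have hjD : j ∉ D := fun hD => h.not_both j hD hU
    have hu : (U ∩ insert j B).card = (U ∩ B).card + 1 := by
      rw [Finset.inter_insert_of_mem hU, Finset.card_insert_of_notMem]
      rw [Finset.mem_inter]
      exact fun hc => hjB hc.2
    have hjP : j ∉ pathVerts n D U B := by
      rw [mem_pathVerts h]
      grind
    have hP : pathVerts n D U (insert j B) = insert j (pathVerts n D U B) := by
      ext v
      rw [Finset.mem_insert, mem_pathVerts h, mem_pathVerts h, Finset.mem_insert]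
      grind
    have hb : (bel n D U (i, k) : ℝ) = bel n D U (i, j) + bel n D U (j, k) - (n + 2) := by
      have := bel_of_mem_up h hij hjk hk hU
      rw [eq_sub_iff_add_eq]
      exact_mod_cast this.symm
    rw [potential, potential, hu, hP, sum_consec_insert hjP hs, coordValue, if_neg hjD, hb]
    push_cast
    ring

theorem potential_supermodular {n : ℕ} {D U B B' : Finset ℕ} (h : Split n D U) {j : ℕ}
    (hj : 1 ≤ j ∧ j ≤ n + 1) (hB : B ⊆ B') (hjB : j ∉ B') :
    potential n D U (insert j B) - potential n D U B ≤
      potential n D U (insert j B') - potential n D U B' := by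
  obtain ⟨i, k, hs⟩ := exists_surrounds_pathVerts h B hj
  obtain ⟨i', k', hs'⟩ := exists_surrounds_pathVerts h B' hj
  rw [potential_insert h hj (fun hc => hjB (hB hc)) hs, potential_insert h hj hjB hs']
  exact coordValue_mono (Finset.card_le_card (Bel_subset_left h hB hs hs'))
    (Finset.card_le_card (Bel_subset_right h hB hs hs')) (bel_le _ _ _) (bel_le _ _ _)

theorem not_mem_before (n : ℕ) (f : ℕ → ℤ) (j : ℕ) : j ∉ before n f j := by
  simp [before]

theorem xcoord_eq_potential {n : ℕ} {D U : Finset ℕ} {T : Finset (ℕ × ℕ)} {f : ℕ → ℤ}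
    (h : Split n D U) (hT : IsTriangulation n D U T) (hf : IncreasesOnSpine n D U T f)
    {j : ℕ} (hj : 1 ≤ j ∧ j ≤ n + 1) :
    xcoord n D U T j =
      potential n D U (insert j (before n f j)) - potential n D U (before n f j) := by
  obtain ⟨i, k, hs⟩ := exists_surrounds_pathVerts h (before n f j) hj
  rw [xcoord_eq h hT hf hj hs, potential_insert h hj (not_mem_before n f j) hs]

/-- The marginal values of a set function along an ordering of `B` telescope. -/
theorem sum_marginal (F : Finset ℕ → ℝ) (f : ℕ → ℤ) (B : Finset ℕ)
    (hinj : ∀ x ∈ B, ∀ y ∈ B, f x = f y → x = y) :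
    ∑ j ∈ B, (F (insert j (B.filter (fun l => f l < f j)))
      - F (B.filter (fun l => f l < f j))) = F B - F ∅ := by
  induction B using Finset.induction_on_max_value f with
  | empty => simp
  | insert a s ha hmax ih =>
    have hlt : ∀ x ∈ s, f x < f a := by
      intro x hx
      refine lt_of_le_of_ne (hmax x hx) fun he => ha ?_
      rwa [← hinj x (Finset.mem_insert_of_mem hx) a (Finset.mem_insert_self a s) he]
    have h1 : (insert a s).filter (fun l => f l < f a) = s := by
      rw [Finset.filter_insert, if_neg (lt_irrefl _), Finset.filter_true_of_mem hlt]
    have h2 : ∀ j ∈ s, (insert a s).filter (fun l => f l < f j)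
        = s.filter (fun l => f l < f j) := by
      intro j hj
      rw [Finset.filter_insert, if_neg (not_lt.2 (hmax j hj))]
    rw [Finset.sum_insert ha, h1, Finset.sum_congr rfl (fun j hj => by rw [h2 j hj]),
      ih (fun x hx y hy => hinj x (Finset.mem_insert_of_mem hx) y (Finset.mem_insert_of_mem hy))]
    ring

theorem potential_sub_le_sum_xcoord {n : ℕ} {D U : Finset ℕ} {T : Finset (ℕ × ℕ)}
    (h : Split n D U) (hT : IsTriangulation n D U T) {B : Finset ℕ}
    (hB : B ⊆ Finset.Icc 1 (n + 1)) :
    potential n D U B - potential n D U ∅ ≤ ∑ j ∈ B, xcoord n D U T j := by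
  obtain ⟨f, hf, hinj⟩ := exists_increasesOnSpine h hT
  have hB' : ∀ x ∈ B, 1 ≤ x ∧ x ≤ n + 1 := fun x hx => Finset.mem_Icc.1 (hB hx)
  rw [← sum_marginal (potential n D U) f B
    (fun x hx y hy => hinj x (hB' x hx).2 y (hB' y hy).2)]
  refine Finset.sum_le_sum fun j hj => ?_
  rw [xcoord_eq_potential h hT hf (hB' j hj)]
  exact potential_supermodular h (hB' j hj) (Finset.filter_subset_filter _ hB)
    (not_mem_before n f j)

theorem sum_xcoord_of_initial {n : ℕ} {D U : Finset ℕ} {T : Finset (ℕ × ℕ)} {f : ℕ → ℤ}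
    (h : Split n D U) (hT : IsTriangulation n D U T) (hf : IncreasesOnSpine n D U T f)
    {B : Finset ℕ} (hB : B ⊆ Finset.Icc 1 (n + 1))
    (hinj : ∀ x ∈ B, ∀ y ∈ B, f x = f y → x = y)
    (hinit : ∀ j ∈ B, before n f j ⊆ B) :
    ∑ j ∈ B, xcoord n D U T j = potential n D U B - potential n D U ∅ := by
  rw [← sum_marginal (potential n D U) f B hinj]
  refine Finset.sum_congr rfl fun j hj => ?_
  have he : B.filter (fun l => f l < f j) = before n f j := by
    refine (Finset.filter_subset_filter _ hB).antisymm fun l hl => ?_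
    exact Finset.mem_filter.2 ⟨hinit j hj hl, (Finset.mem_filter.1 hl).2⟩
  rw [xcoord_eq_potential h hT hf (Finset.mem_Icc.1 (hB hj)), he]

theorem sum_xcoord {n : ℕ} {D U : Finset ℕ} {T : Finset (ℕ × ℕ)}
    (h : Split n D U) (hT : IsTriangulation n D U T) :
    ∑ j ∈ Finset.Icc 1 (n + 1), xcoord n D U T j =
      potential n D U (Finset.Icc 1 (n + 1)) - potential n D U ∅ := by
  obtain ⟨f, hf, hinj⟩ := exists_increasesOnSpine h hT
  exact sum_xcoord_of_initial h hT hf subset_rfl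
    (fun x hx y hy => hinj x (Finset.mem_Icc.1 hx).2 y (Finset.mem_Icc.1 hy).2)
    (fun j _ => Finset.filter_subset _ _)

/-- Abel summation: partial sums that are nonnegative lose mass when weighted monotonically. -/
theorem sum_mul_le_of_partial_sums_nonneg (v e : ℕ → ℝ) (m : ℕ)
    (hv : ∀ k ∈ Finset.Icc 1 m, v k ≤ v (k + 1))
    (he : ∀ k ≤ m, 0 ≤ ∑ l ∈ Finset.Icc 1 k, e l) :
    ∑ l ∈ Finset.Icc 1 (m + 1), v l * e l ≤ v (m + 1) * ∑ l ∈ Finset.Icc 1 (m + 1), e l := by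
  induction m with
  | zero => simp
  | succ m ih =>
    rw [Finset.sum_Icc_succ_top (by omega), Finset.sum_Icc_succ_top (by omega : 1 ≤ m + 1 + 1)]
    have h1 := ih (fun k hk => hv k (by rw [Finset.mem_Icc] at hk ⊢; omega))
      (fun k hk => he k (by omega))
    have h2 := mul_le_mul_of_nonneg_right
      (hv (m + 1) (by rw [Finset.mem_Icc]; omega)) (he (m + 1) le_rfl)
    linarith [mul_add (v (m + 1 + 1)) (∑ l ∈ Finset.Icc 1 (m + 1), e l) (e (m + 1 + 1))]

theorem symm_mem_Icc {m : ℕ} {σ : Equiv.Perm ℕ}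
    (hσ : ∀ j ∈ Finset.Icc 1 m, σ j ∈ Finset.Icc 1 m) {k : ℕ} (hk : k ∈ Finset.Icc 1 m) :
    σ.symm k ∈ Finset.Icc 1 m := by
  have hi : (Finset.Icc 1 m).image σ = Finset.Icc 1 m :=
    Finset.eq_of_subset_of_card_le (Finset.image_subset_iff.2 hσ)
      (Finset.card_image_of_injective _ σ.injective).ge
  rw [← hi, Finset.mem_image] at hk
  obtain ⟨j, hj, rfl⟩ := hk
  rwa [σ.symm_apply_apply]

theorem sum_mul_xcoord_le {n : ℕ} {D U : Finset ℕ} {T T' : Finset (ℕ × ℕ)}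
    (h : Split n D U) (hT : IsTriangulation n D U T) (hT' : IsTriangulation n D U T')
    {σ : Equiv.Perm ℕ} (hσ : ∀ j ∈ Finset.Icc 1 (n + 1), σ j ∈ Finset.Icc 1 (n + 1))
    (hf : IncreasesOnSpine n D U T (fun j => (σ j : ℤ))) {u : ℕ → ℝ}
    (hu : ∀ k ∈ Finset.Icc 1 n, u (σ.symm k) ≤ u (σ.symm (k + 1))) :
    ∑ j ∈ Finset.Icc 1 (n + 1), u j * xcoord n D U T' j
      ≤ ∑ j ∈ Finset.Icc 1 (n + 1), u j * xcoord n D U T j := by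
  have hreindex : ∀ m ≤ n + 1, ∀ g : ℕ → ℝ, ∑ k ∈ Finset.Icc 1 m, g (σ.symm k) =
      ∑ j ∈ (Finset.Icc 1 m).image σ.symm, g j := fun m _ g =>
    (Finset.sum_image fun x _ y _ hxy => σ.symm.injective hxy).symm
  have hsub : ∀ m ≤ n + 1, (Finset.Icc 1 m).image σ.symm ⊆ Finset.Icc 1 (n + 1) := by
    intro m hm
    refine Finset.image_subset_iff.2 fun k hk => symm_mem_Icc hσ ?_
    exact Finset.Icc_subset_Icc_right hm hk
  have hfull : (Finset.Icc 1 (n + 1)).image σ.symm = Finset.Icc 1 (n + 1) :=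
    Finset.eq_of_subset_of_card_le (hsub _ le_rfl)
      (Finset.card_image_of_injective _ σ.symm.injective).ge
  have hpartial : ∀ m ≤ n,
      0 ≤ ∑ k ∈ Finset.Icc 1 m, (xcoord n D U T' (σ.symm k) - xcoord n D U T (σ.symm k)) := by
    intro m hm
    rw [hreindex m (by omega) (fun j => xcoord n D U T' j - xcoord n D U T j),
      Finset.sum_sub_distrib, sum_xcoord_of_initial h hT hf (hsub m (by omega))
        (fun x _ y _ hxy => σ.injective (by exact_mod_cast hxy)) ?_, sub_nonneg]
    · exact potential_sub_le_sum_xcoord h hT' (hsub m (by omega))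
    · intro j hj l hl
      rw [Finset.mem_image] at hj ⊢
      obtain ⟨k, hk, rfl⟩ := hj
      rw [before, Finset.mem_filter] at hl
      have h1 := hσ l hl.1
      have h2 := hl.2
      rw [σ.apply_symm_apply] at h2
      refine ⟨σ l, ?_, σ.symm_apply_apply l⟩
      rw [Finset.mem_Icc] at h1 hk ⊢
      omega
  have habel := sum_mul_le_of_partial_sums_nonneg (fun k => u (σ.symm k))
    (fun k => xcoord n D U T' (σ.symm k) - xcoord n D U T (σ.symm k)) n hu hpartial
  rw [hreindex (n + 1) le_rfl (fun j => xcoord n D U T' j - xcoord n D U T j),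
    hreindex (n + 1) le_rfl (fun j => u j * (xcoord n D U T' j - xcoord n D U T j)), hfull,
    Finset.sum_sub_distrib, sum_xcoord h hT, sum_xcoord h hT', sub_self, mul_zero] at habel
  simp only [mul_sub, Finset.sum_sub_distrib] at habel
  linarith

/-- For every permutation `σ` of `[n+1]` there is exactly one
triangulation `T` of `P` such that `σ` is a linear extension of the spine of `T`;
moreover, for this `T`, every `u` with `u_{σ⁻¹(1)} ≤ … ≤ u_{σ⁻¹(n+1)}` is maximized at
`x(T)` among all points `x(T')`. -/
theorem surjection_unique_linear_extension (n : ℕ) (hn : 1 ≤ n) (D U : Finset ℕ)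
    (hUD : D ∪ U = Finset.Icc 1 (n + 1)) (hdisj : Disjoint D U)
    (σ : Equiv.Perm ℕ) (hσ : ∀ j ∈ Finset.Icc 1 (n + 1), σ j ∈ Finset.Icc 1 (n + 1)) :
    (∃! T : Finset (ℕ × ℕ), IsTriangulation n D U T ∧
      ∀ δ ∈ T, σ (spineSrc n D U T δ) < σ (spineTgt n D U T δ)) ∧
    (∀ T : Finset (ℕ × ℕ), IsTriangulation n D U T →
      (∀ δ ∈ T, σ (spineSrc n D U T δ) < σ (spineTgt n D U T δ)) →
      ∀ u : ℕ → ℝ, (∀ k ∈ Finset.Icc 1 n, u (σ.symm k) ≤ u (σ.symm (k + 1))) →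
        ∀ T' : Finset (ℕ × ℕ), IsTriangulation n D U T' →
          ∑ j ∈ Finset.Icc 1 (n + 1), u j * xcoord n D U T' j
            ≤ ∑ j ∈ Finset.Icc 1 (n + 1), u j * xcoord n D U T j) := by
  have h : Split n D U :=
    ⟨fun v => by rw [← Finset.mem_union, hUD, Finset.mem_Icc],
      fun _ hv => Finset.disjoint_left.1 hdisj hv⟩
  have hinj : ∀ x y : ℕ, (σ x : ℤ) = σ y → x = y := fun x y hxy =>
    σ.injective (by exact_mod_cast hxy)
  have hspine : ∀ T : Finset (ℕ × ℕ), IsTriangulation n D U T →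
      (IncreasesOnSpine n D U T (fun j => (σ j : ℤ)) ↔
        ∀ δ ∈ T, σ (spineSrc n D U T δ) < σ (spineTgt n D U T δ)) := fun T hT => by
    simp only [increasesOnSpine_iff h hT, Nat.cast_lt]
  have hT₀ := isTriangulation_orderTriangulation h hinj
  refine ⟨⟨orderTriangulation n D U (fun j => (σ j : ℤ)),
    ⟨hT₀, (hspine _ hT₀).1 (increasesOnSpine_orderTriangulation h hinj)⟩, ?_⟩, ?_⟩
  · rintro T ⟨hT, hlin⟩
    exact eq_orderTriangulation h hT hinj ((hspine T hT).2 hlin)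
  · intro T hT hlin u hu T' hT'
    exact sum_mul_xcoord_le h hT hT' hσ ((hspine T hT).2 hlin) hu

end Spines
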